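/- arXiv:2007.05668 — 2 statements merged into one kernel-verified Lean document; each statement's English description precedes it below -/
import Mathlib

section
/- Weighted interpolation against the adapted Hölder norm (Proposition 2.16 in the one-dimensional case): Let m ≥ 2 be an integer and σ_m ∈ ℝ with σ_m > (m−2)/2 and m − 1 − σ_m > 0. For 0 < j < m set θ_j = j/m, σ_j = σ_m θ_j − (1−θ_j)/2, 1/p_j = θ_j/2. Then there is a constant C, depending only on m and σ_m, such that for every f ∈ C^m((0,∞)) with ‖f‖_{C̃^{0,1/2}} < ∞ and ‖x^{σ_m} f^{(m)}‖_{L²(0,∞)} < ∞, and every 0 < j < m, ‖x^{σ_j} f^{(j)}‖_{L^{p_j}(0,∞)} ≤ C ‖f‖_{C̃^{0,1/2}}^{1−θ_j} ‖x^{σ_m} f^{(m)}‖_{L²(0,∞)}^{θ_j}. -/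
open MeasureTheory Set
open scoped ENNReal

/-- The weighted Lebesgue norm `‖x^σ f‖_{L^p(0,∞)}`. -/
noncomputable def wLp (σ : ℝ) (p : ℝ≥0∞) (f : ℝ → ℝ) : ℝ≥0∞ :=
  eLpNorm (fun x => x ^ σ * f x) p (volume.restrict (Set.Ioi 0))

theorem exists_abs_iteratedDeriv_mul_pow_le (n : ℕ) (hn : 1 ≤ n) :
    ∃ C : ℝ, 0 ≤ C ∧ ∀ (F : ℕ → ℝ → ℝ) (a l M : ℝ), 0 < l →
      (∀ k < n, ∀ x ∈ Icc a (a + l), HasDerivAt (F k) (F (k + 1) x) x) →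
      (∀ x ∈ Icc a (a + l), ∀ y ∈ Icc a (a + l), |F 0 x - F 0 y| ≤ M) →
      ∃ ξ ∈ Icc a (a + l), |F n ξ| * l ^ n ≤ C * M := by
  induction n, hn using Nat.le_induction with
  | base =>
    refine ⟨1, zero_le_one, fun F a l M hl hF hM => ?_⟩
    obtain ⟨ξ, hξ, h⟩ := exists_hasDerivAt_eq_slope (F 0) (F 1) (by linarith : a < a + l)
      (fun x hx => (hF 0 one_pos x hx).continuousAt.continuousWithinAt)
      (fun x hx => hF 0 one_pos x (Ioo_subset_Icc_self hx))
    refine ⟨ξ, Ioo_subset_Icc_self hξ, ?_⟩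
    have h2 : F 1 ξ * l = F 0 (a + l) - F 0 a := by
      rw [h, add_sub_cancel_left, div_mul_cancel₀ _ hl.ne']
    rw [pow_one, one_mul, show |F 1 ξ| * l = |F 1 ξ * l| by rw [abs_mul, abs_of_pos hl], h2]
    exact hM _ ⟨by linarith, le_rfl⟩ _ ⟨le_rfl, by linarith⟩
  | succ n hn ih =>
    obtain ⟨C, hC, ih⟩ := ih
    refine ⟨2 * C * 3 ^ (n + 1), by positivity, fun F a l M hl hF hM => ?_⟩
    have hs1 : Icc a (a + l / 3) ⊆ Icc a (a + l) := Icc_subset_Icc le_rfl (by linarith)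
    have hs2 : Icc (a + 2 * l / 3) (a + 2 * l / 3 + l / 3) ⊆ Icc a (a + l) :=
      Icc_subset_Icc (by linarith) (by linarith)
    obtain ⟨ξ, hξ, h1⟩ := ih F a (l / 3) M (by positivity)
      (fun k hk x hx => hF k (by omega) x (hs1 hx))
      (fun x hx y hy => hM x (hs1 hx) y (hs1 hy))
    obtain ⟨η, hη, h2⟩ := ih F (a + 2 * l / 3) (l / 3) M (by positivity)
      (fun k hk x hx => hF k (by omega) x (hs2 hx))
      (fun x hx y hy => hM x (hs2 hx) y (hs2 hy))
    have hlt : l / 3 ≤ η - ξ := by linarith [hξ.2, hη.1]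
    have hsub : Icc ξ η ⊆ Icc a (a + l) := Icc_subset_Icc hξ.1 (hs2 hη).2
    obtain ⟨ζ, hζ, h⟩ := exists_hasDerivAt_eq_slope (F n) (F (n + 1)) (by linarith : ξ < η)
      (fun x hx => (hF n (by omega) x (hsub hx)).continuousAt.continuousWithinAt)
      (fun x hx => hF n (by omega) x (hsub (Ioo_subset_Icc_self hx)))
    refine ⟨ζ, hsub (Ioo_subset_Icc_self hζ), ?_⟩
    have h3 : |F (n + 1) ζ| * (η - ξ) = |F n η - F n ξ| := by
      rw [h, abs_div, abs_of_pos (by linarith : 0 < η - ξ)]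
      field_simp [(by linarith : η - ξ ≠ 0)]
    have h4 : |F (n + 1) ζ| * (l / 3) ≤ |F n η| + |F n ξ| :=
      calc |F (n + 1) ζ| * (l / 3) ≤ |F (n + 1) ζ| * (η - ξ) := by gcongr
        _ ≤ _ := by rw [h3]; exact abs_sub _ _
    calc |F (n + 1) ζ| * l ^ (n + 1)
        = (|F (n + 1) ζ| * (l / 3)) * (l / 3) ^ n * 3 ^ (n + 1) := by
          rw [div_pow]; field_simp; ring
      _ ≤ (|F n η| + |F n ξ|) * (l / 3) ^ n * 3 ^ (n + 1) := by gcongr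
      _ ≤ (C * M + C * M) * 3 ^ (n + 1) := by rw [add_mul]; gcongr
      _ = _ := by ring

theorem abs_sub_le_intervalIntegral_abs {u v : ℝ → ℝ} {a b s t : ℝ} (hab : a ≤ b)
    (hu : ∀ x ∈ Icc a b, HasDerivAt u (v x) x) (hv : ContinuousOn v (Icc a b))
    (hs : s ∈ Icc a b) (ht : t ∈ Icc a b) : |u t - u s| ≤ ∫ x in a..b, |v x| := by
  have hsub : uIcc s t ⊆ Icc a b := ordConnected_Icc.uIcc_subset hs ht
  rw [← intervalIntegral.integral_eq_sub_of_hasDerivAt (fun x hx => hu x (hsub hx))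
    (hv.mono hsub).intervalIntegrable]
  have h := intervalIntegral.norm_integral_le_abs_integral_norm (f := v) (a := s) (b := t)
    (μ := volume)
  simp only [Real.norm_eq_abs] at h
  refine h.trans ?_
  have hi : IntervalIntegrable (fun x => |v x|) volume a b :=
    (hv.abs.mono (by rw [uIcc_of_le hab])).intervalIntegrable
  refine (intervalIntegral.abs_integral_mono_interval (c := a) (d := b) ?_
    (Filter.Eventually.of_forall fun x => abs_nonneg _) hi).trans_eq ?_
  · rw [uIoc_of_le hab]
    intro x hx
    exact ⟨(le_min hs.1 ht.1).trans_lt hx.1, hx.2.trans (max_le hs.2 ht.2)⟩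
  · exact abs_of_nonneg (intervalIntegral.integral_nonneg hab fun x _ => abs_nonneg _)

theorem abs_intermediate_deriv_mul_pow_le (m k : ℕ) (hk : 1 ≤ k) (hkm : k < m) :
    ∃ C : ℝ, 0 ≤ C ∧ ∀ (F : ℕ → ℝ → ℝ) (a l M : ℝ), 0 < l →
      (∀ k < m, ∀ x ∈ Icc a (a + l), HasDerivAt (F k) (F (k + 1) x) x) →
      ContinuousOn (F m) (Icc a (a + l)) →
      (∀ x ∈ Icc a (a + l), ∀ y ∈ Icc a (a + l), |F 0 x - F 0 y| ≤ M) →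
      (∫ x in a..(a + l), |F m x|) * l ^ (m - 1) ≤ M →
      ∀ t ∈ Icc a (a + l), |F k t| * l ^ k ≤ C * M := by
  obtain ⟨d, rfl⟩ := Nat.exists_eq_add_of_lt hkm
  clear hkm
  induction d generalizing k with
  | zero =>
    obtain ⟨C, hC, h⟩ := exists_abs_iteratedDeriv_mul_pow_le k hk
    refine ⟨C + 1, by positivity, fun F a l M hl hF hc hM hI t ht => ?_⟩
    obtain ⟨ξ, hξ, h1⟩ := h F a l M hl (fun i hi => hF i (by omega)) hM
    have h2 := abs_sub_le_intervalIntegral_abs (by linarith) (hF k (by omega)) hc hξ ht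
    have h3 : |F k t| ≤ |F k t - F k ξ| + |F k ξ| := by
      simpa using abs_add_le (F k t - F k ξ) (F k ξ)
    simp only [add_zero, Nat.add_sub_cancel] at hI h2
    calc |F k t| * l ^ k ≤ ((∫ x in a..(a + l), |F (k + 1) x|) + |F k ξ|) * l ^ k := by
          gcongr; linarith
      _ ≤ _ := by linarith
  | succ d ih =>
    obtain ⟨C, hC, h⟩ := exists_abs_iteratedDeriv_mul_pow_le k hk
    obtain ⟨C', hC', h'⟩ := ih (k + 1) (by omega)
    have e : k + 1 + d + 1 = k + (d + 1) + 1 := by omega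
    rw [e] at h'
    refine ⟨C + C', by positivity, fun F a l M hl hF hc hM hI t ht => ?_⟩
    obtain ⟨ξ, hξ, h1⟩ := h F a l M hl (fun i hi => hF i (by omega)) hM
    have h' := h' F a l M hl hF hc hM hI
    have hle : ∀ x ∈ Icc a (a + l), ‖F (k + 1) x‖ ≤ C' * M / l ^ (k + 1) := fun x hx => by
      rw [le_div_iff₀ (by positivity)]; exact h' x hx
    have h2 := (convex_Icc a (a + l)).norm_image_sub_le_of_norm_hasDerivWithin_le
      (fun x hx => (hF k (by omega) x hx).hasDerivWithinAt) hle hξ ht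
    rw [Real.norm_eq_abs, Real.norm_eq_abs] at h2
    have h4 : |t - ξ| ≤ l := by rw [abs_le]; constructor <;> linarith [hξ.1, hξ.2, ht.1, ht.2]
    have hnn : 0 ≤ C' * M / l ^ (k + 1) := (norm_nonneg _).trans (hle ξ hξ)
    have h3 : |F k t| ≤ |F k t - F k ξ| + |F k ξ| := by
      simpa using abs_add_le (F k t - F k ξ) (F k ξ)
    calc |F k t| * l ^ k ≤ (C' * M / l ^ (k + 1) * l + |F k ξ|) * l ^ k := by
          gcongr
          refine h3.trans ?_
          gcongr
          exact h2.trans (by gcongr)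
      _ = C' * M + |F k ξ| * l ^ k := by field_simp; ring
      _ ≤ _ := by linarith

theorem rpow_le_two_rpow_mul {x y r : ℝ} (hx : 0 < x) (hxy : x ≤ 2 * y) (hyx : y ≤ 2 * x) :
    x ^ r ≤ 2 ^ |r| * y ^ r := by
  have hy : 0 < y := by linarith
  rw [← div_le_iff₀ (by positivity), ← Real.div_rpow hx.le hy.le]
  rcases le_total 0 r with hr | hr
  · rw [abs_of_nonneg hr]
    exact Real.rpow_le_rpow (by positivity) (by rwa [div_le_iff₀ hy]) hr
  · rw [abs_of_nonpos hr, Real.rpow_neg two_pos.le, ← Real.inv_rpow two_pos.le]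
    exact Real.rpow_le_rpow_of_nonpos (by positivity) (by rw [le_div_iff₀ hy]; linarith) hr

theorem rpow_mul_integral_le {h : ℝ → ℝ} {x l : ℝ} (r : ℝ) (hx : 0 < x) (hl : 0 ≤ l)
    (hlx : l ≤ x) (hh : ContinuousOn h (Icc x (x + l))) (hn : ∀ t ∈ Icc x (x + l), 0 ≤ h t) :
    x ^ r * ∫ t in x..(x + l), h t ≤ 2 ^ |r| * ∫ t in x..(x + l), t ^ r * h t := by
  have hle : x ≤ x + l := by linarith
  rw [← intervalIntegral.integral_const_mul, ← intervalIntegral.integral_const_mul]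
  have hr : ContinuousOn (fun t : ℝ => t ^ r) (Icc x (x + l)) := fun t ht =>
    (Real.continuousAt_rpow_const t r (Or.inl (hx.trans_le ht.1).ne')).continuousWithinAt
  refine intervalIntegral.integral_mono_on hle ?_ ?_ fun t ht => ?_
  · exact (continuousOn_const.mul hh).intervalIntegrable_of_Icc hle
  · exact (continuousOn_const.mul (hr.mul hh)).intervalIntegrable_of_Icc hle
  · rw [← mul_assoc]
    exact mul_le_mul_of_nonneg_right
      (rpow_le_two_rpow_mul hx (by linarith [ht.1]) (by linarith [ht.2])) (hn t ht)

theorem integral_abs_mul_pow_le {g : ℝ → ℝ} {m : ℕ} {a l s : ℝ} (hm : 1 ≤ m) (hl : 0 < l)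
    (hs : 0 < s) (hg : ContinuousOn g (Icc a (a + l)))
    (h : (∫ t in a..(a + l), g t ^ 2) * l ^ (2 * m - 1) ≤ s ^ 2) :
    (∫ t in a..(a + l), |g t|) * l ^ (m - 1) ≤ 2 * s := by
  obtain ⟨n, rfl⟩ : ∃ n, m = n + 1 := ⟨m - 1, by omega⟩
  rw [show 2 * (n + 1) - 1 = 2 * n + 1 by omega] at h
  rw [Nat.add_sub_cancel]
  have hle : a ≤ a + l := by linarith
  have hi : IntervalIntegrable (fun t => l ^ (n + 1) / s * g t ^ 2) volume a (a + l) :=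
    (continuousOn_const.mul (hg.pow 2)).intervalIntegrable_of_Icc hle
  have h1 : ∫ t in a..(a + l), |g t| ≤
      ∫ t in a..(a + l), (l ^ (n + 1) / s * g t ^ 2 + s / l ^ (n + 1)) := by
    refine intervalIntegral.integral_mono_on hle (hg.abs.intervalIntegrable_of_Icc hle)
      (hi.add intervalIntegrable_const) fun t _ => ?_
    have hp : 0 < l ^ (n + 1) / s := by positivity
    rw [← sq_abs, ← inv_div (l ^ (n + 1)) s]
    generalize l ^ (n + 1) / s = c at hp ⊢
    have : 0 ≤ (c * |g t| - 1) ^ 2 + c * |g t| := by positivity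
    have h3 : c * |g t| ≤ c * (c * |g t| ^ 2 + c⁻¹) := by
      rw [mul_add, mul_inv_cancel₀ hp.ne']; nlinarith
    exact le_of_mul_le_mul_left h3 hp
  rw [intervalIntegral.integral_add hi intervalIntegrable_const,
    intervalIntegral.integral_const_mul, intervalIntegral.integral_const, smul_eq_mul,
    add_sub_cancel_left] at h1
  calc (∫ t in a..(a + l), |g t|) * l ^ n
      ≤ (l ^ (n + 1) / s * (∫ t in a..(a + l), g t ^ 2) + l * (s / l ^ (n + 1))) * l ^ n := by
        gcongr
    _ = ((∫ t in a..(a + l), g t ^ 2) * l ^ (2 * n + 1)) / s + s := by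
        field_simp; ring
    _ ≤ s ^ 2 / s + s := by gcongr
    _ = 2 * s := by field_simp; ring

theorem exists_ge_of_forall_exists_gt {Ψ : ℝ → ℝ} {a : ℝ} (hΨ : ContinuousOn Ψ (Ici a))
    (h : ∀ x ∈ Ici a, ∃ y, x < y ∧ Ψ x ≤ Ψ y) (b : ℝ) : ∃ y, a ≤ y ∧ b ≤ y ∧ Ψ a ≤ Ψ y := by
  by_contra! hb
  set S := {y | y ∈ Ici a ∧ Ψ a ≤ Ψ y}
  have hS : IsClosed S := by
    have : S = Ici a ∩ Ψ ⁻¹' (Ici (Ψ a)) := rfl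
    rw [this]
    exact hΨ.preimage_isClosed_of_isClosed isClosed_Ici isClosed_Ici
  have hne : S.Nonempty := ⟨a, self_mem_Ici, le_rfl⟩
  have hbd : BddAbove S := ⟨b, fun y hy => by
    by_contra! hlt
    exact absurd hy.2 (not_le.2 (hb y hy.1 hlt.le))⟩
  obtain ⟨h1, h2⟩ := hS.csSup_mem hne hbd
  obtain ⟨y, hy, hΨy⟩ := h _ h1
  exact absurd (le_csSup hbd (show y ∈ S from ⟨(mem_Ici.1 h1).trans hy.le, h2.trans hΨy⟩))
    (not_le.2 hy)

theorem exists_right_step (m j : ℕ) (hj : 1 ≤ j) (hjm : j < m) (σ : ℝ) :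
    ∃ K : ℝ, 0 ≤ K ∧ ∀ F : ℕ → ℝ → ℝ,
      (∀ k < m, ∀ x ∈ Ioi (0 : ℝ), HasDerivAt (F k) (F (k + 1) x) x) →
      ContinuousOn (F m) (Ioi 0) →
      (∀ x ∈ Ioi (0 : ℝ), ∀ y ∈ Ioi (0 : ℝ), |F 0 x - F 0 y| ≤ √x + √y + √|x - y|) →
      ∀ x, 0 < x → ∃ y, x < y ∧
        ∫ t in x..y, t ^ (2 * σ + 1 - m / j) * |F j t| ^ (2 * (m : ℝ) / j) ≤
          K * ((∫ t in x..y, t ^ (2 * σ) * F m t ^ 2) + ∫ t in x..y, t ^ (2 * σ + 1 - 2 * m)) := by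
  obtain ⟨C, hC, hloc⟩ := abs_intermediate_deriv_mul_pow_le m j hj hjm
  have hj0 : (0 : ℝ) < j := by exact_mod_cast hj
  have hm0 : (0 : ℝ) < m := by exact_mod_cast (by omega : 0 < m)
  set q : ℝ := 2 * σ + 1 - m / j with hq
  set p : ℝ := 2 * (m : ℝ) / j with hp
  have hp0 : 0 < p := by positivity
  set K₁ : ℝ := 2 ^ |q| * (C * 4) ^ p with hK₁
  have hK₁0 : 0 ≤ K₁ := by positivity
  refine ⟨K₁ * (2 ^ |2 * σ| + 2 ^ |2 * σ + 1 - 2 * m|), by positivity,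
    fun F hF hc hosc x hx => ?_⟩
  have hsub : ∀ {l : ℝ}, Icc x (x + l) ⊆ Ioi 0 := by
    intro l t ht
    exact hx.trans_le ht.1
  have hcI : ContinuousOn (fun t => F m t ^ 2) (Ioi 0) := hc.pow 2
  obtain ⟨l, hl, hlx, hle, hdich⟩ : ∃ l, 0 < l ∧ l ≤ x ∧
      (∫ t in x..(x + l), F m t ^ 2) * l ^ (2 * m - 1) ≤ x ∧
      (l = x ∨ (∫ t in x..(x + l), F m t ^ 2) * l ^ (2 * m - 1) = x) := by
    set φ : ℝ → ℝ := fun l => (∫ t in x..(x + l), F m t ^ 2) * l ^ (2 * m - 1) with hφ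
    rcases le_or_gt (φ x) x with h | h
    · exact ⟨x, hx, le_rfl, h, Or.inl rfl⟩
    · have hφc : ContinuousOn φ (Icc 0 x) := by
        refine ContinuousOn.mul ?_ (by fun_prop)
        have h1 : ContinuousOn (fun y => ∫ t in x..y, F m t ^ 2) (uIcc x (x + x)) := by
          refine intervalIntegral.continuousOn_primitive_interval ?_
          rw [uIcc_of_le (by linarith)]
          exact (hcI.mono hsub).integrableOn_Icc
        refine h1.comp (by fun_prop) fun l hl => ?_
        rw [uIcc_of_le (by linarith)]
        exact ⟨by linarith [hl.1], by linarith [hl.2]⟩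
      have hφ0 : φ 0 = 0 := by simp [hφ]
      obtain ⟨l, hl, hlφ⟩ := intermediate_value_Icc hx.le hφc
        (show x ∈ Icc (φ 0) (φ x) from ⟨by rw [hφ0]; exact hx.le, h.le⟩)
      have hl0 : l ≠ 0 := by
        rintro rfl
        exact hx.ne (hφ0.symm.trans hlφ)
      exact ⟨l, lt_of_le_of_ne hl.1 hl0.symm, hl.2, hlφ.le, Or.inr hlφ⟩
  refine ⟨x + l, by linarith, ?_⟩
  have hxl : x ≤ x + l := by linarith
  have hsx : 0 < √x := Real.sqrt_pos.2 hx
  have hosc' : ∀ s ∈ Icc x (x + l), ∀ t ∈ Icc x (x + l), |F 0 s - F 0 t| ≤ 4 * √x := by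
    intro s hs t ht
    have h4 : √(4 * x / 2 ) ≤ 3 / 2 * √x := by
      rw [Real.sqrt_le_left (by positivity), mul_pow, Real.sq_sqrt hx.le]; linarith
    have h1 : √s ≤ 3 / 2 * √x := (Real.sqrt_le_sqrt (by linarith [hs.2])).trans h4
    have h2 : √t ≤ 3 / 2 * √x := (Real.sqrt_le_sqrt (by linarith [ht.2])).trans h4
    have h3 : √|s - t| ≤ √x := Real.sqrt_le_sqrt (by
      rw [abs_le]; constructor <;> linarith [hs.1, hs.2, ht.1, ht.2])
    linarith [hosc s (hsub hs) t (hsub ht)]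
  have hI := integral_abs_mul_pow_le (by omega) hl hsx (hc.mono hsub)
    (hle.trans_eq (Real.sq_sqrt hx.le).symm)
  have hbd := hloc F x l (4 * √x) hl (fun k hk t ht => hF k hk t (hsub ht)) (hc.mono hsub) hosc'
    (hI.trans (by linarith))
  have hw : ∀ t ∈ Icc x (x + l), t ^ q * |F j t| ^ p ≤ K₁ * x ^ (2 * σ + 1) / l ^ (2 * m) := by
    intro t ht
    have ht0 : 0 < t := hsub ht
    have e1 : (l ^ j) ^ p = l ^ (2 * m) := by
      rw [← Real.rpow_natCast l j, ← Real.rpow_mul hl.le, hp, ← Real.rpow_natCast]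
      congr 1; push_cast; field_simp
    have e2 : √x ^ p = x ^ ((m : ℝ) / j) := by
      rw [Real.sqrt_eq_rpow, ← Real.rpow_mul hx.le, hp]
      congr 1; field_simp
    have h1 : |F j t| ^ p * l ^ (2 * m) ≤ (C * 4) ^ p * x ^ ((m : ℝ) / j) := by
      rw [← e1, ← e2, ← Real.mul_rpow (abs_nonneg _) (by positivity),
        ← Real.mul_rpow (by positivity) (by positivity)]
      exact Real.rpow_le_rpow (by positivity) ((hbd t ht).trans_eq (by ring)) hp0.le
    have h2 : t ^ q ≤ 2 ^ |q| * x ^ q :=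
      rpow_le_two_rpow_mul ht0 (by linarith [ht.2]) (by linarith [ht.1])
    rw [le_div_iff₀ (by positivity)]
    calc t ^ q * |F j t| ^ p * l ^ (2 * m) = t ^ q * (|F j t| ^ p * l ^ (2 * m)) := by ring
      _ ≤ (2 ^ |q| * x ^ q) * ((C * 4) ^ p * x ^ ((m : ℝ) / j)) := by gcongr
      _ = K₁ * (x ^ q * x ^ ((m : ℝ) / j)) := by rw [hK₁]; ring
      _ = K₁ * x ^ (2 * σ + 1) := by
        rw [← Real.rpow_add hx, hq]; congr 2; ring
  have hintegral : ∫ t in x..(x + l), t ^ q * |F j t| ^ p ≤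
      K₁ * x ^ (2 * σ + 1) / l ^ (2 * m) * l := by
    have := intervalIntegral.norm_integral_le_of_norm_le_const (a := x) (b := x + l)
      (f := fun t => t ^ q * |F j t| ^ p) (C := K₁ * x ^ (2 * σ + 1) / l ^ (2 * m)) fun t ht => by
        rw [uIoc_of_le hxl] at ht
        have ht' : t ∈ Icc x (x + l) := Ioc_subset_Icc_self ht
        have ht0 : 0 < t := hsub ht'
        rw [Real.norm_of_nonneg (by positivity)]
        exact hw t ht'
    rw [add_sub_cancel_left, abs_of_pos hl] at this
    exact (le_abs_self _).trans this
  have hA : 0 ≤ ∫ t in x..(x + l), t ^ (2 * σ) * F m t ^ 2 :=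
    intervalIntegral.integral_nonneg hxl fun t ht => by
      have : 0 < t := hsub ht
      positivity
  have hB : 0 ≤ ∫ t in x..(x + l), t ^ (2 * σ + 1 - 2 * (m : ℝ)) :=
    intervalIntegral.integral_nonneg hxl fun t ht => by
      have : 0 < t := hsub ht
      positivity
  refine hintegral.trans ?_
  rcases hdich with rfl | heq
  · have h1 := rpow_mul_integral_le (h := fun _ => 1) (2 * σ + 1 - 2 * (m : ℝ)) hx hl.le le_rfl
      continuousOn_const (fun _ _ => zero_le_one)
    simp only [mul_one, intervalIntegral.integral_const, smul_eq_mul, add_sub_cancel_left] at h1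
    calc K₁ * l ^ (2 * σ + 1) / l ^ (2 * m) * l
        = K₁ * (l ^ (2 * σ + 1 - 2 * (m : ℝ)) * l) := by
          rw [Real.rpow_sub hx, ← Real.rpow_natCast l (2 * m)]; push_cast; ring
      _ ≤ K₁ * (2 ^ |2 * σ + 1 - 2 * (m : ℝ)| *
            ∫ t in l..(l + l), t ^ (2 * σ + 1 - 2 * (m : ℝ))) := by gcongr
      _ ≤ _ := by
        rw [mul_assoc K₁]
        exact mul_le_mul_of_nonneg_left (mul_le_mul (le_add_of_nonneg_left (by positivity))
          (le_add_of_nonneg_left hA) hB (by positivity)) hK₁0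
  · have h1 := rpow_mul_integral_le (2 * σ) hx hl.le hlx (hcI.mono hsub) fun _ _ => sq_nonneg _
    calc K₁ * x ^ (2 * σ + 1) / l ^ (2 * m) * l
        = K₁ * (x ^ (2 * σ) * (x * (l / l ^ (2 * m)))) := by
          rw [Real.rpow_add hx, Real.rpow_one]; ring
      _ = K₁ * (x ^ (2 * σ) * ∫ t in x..(x + l), F m t ^ 2) := by
          congr 2
          have : l ^ (2 * m) = l ^ (2 * m - 1) * l := by
            rw [← pow_succ]; congr 1; omega
          rw [this]
          nth_rewrite 1 [← heq]
          field_simp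
      _ ≤ K₁ * (2 ^ |2 * σ| * ∫ t in x..(x + l), t ^ (2 * σ) * F m t ^ 2) := by gcongr
      _ ≤ _ := by
        rw [mul_assoc K₁]
        exact mul_le_mul_of_nonneg_left (mul_le_mul (le_add_of_nonneg_right (by positivity))
          (le_add_of_nonneg_right hB) hA (by positivity)) hK₁0

theorem continuousOn_rpow_mul_abs_rpow {u : ℝ → ℝ} {q p : ℝ} (hp : 0 ≤ p)
    (hu : ContinuousOn u (Ioi 0)) : ContinuousOn (fun t => t ^ q * |u t| ^ p) (Ioi 0) :=
  ContinuousOn.mul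
    (fun t ht => (Real.continuousAt_rpow_const t q (Or.inl (ne_of_gt ht))).continuousWithinAt)
    (hu.abs.rpow_const fun _ _ => Or.inr hp)

theorem Icc_subset_Ioi_zero {a b : ℝ} (ha : 0 < a) : Icc a b ⊆ Ioi 0 :=
  fun _ ht => ha.trans_le ht.1

theorem exists_right_bound (m j : ℕ) (hj : 1 ≤ j) (hjm : j < m) (σ : ℝ) (hσ : σ < m - 1) :
    ∃ K : ℝ, 0 ≤ K ∧ ∀ F : ℕ → ℝ → ℝ,
      (∀ k < m, ∀ x ∈ Ioi (0 : ℝ), HasDerivAt (F k) (F (k + 1) x) x) →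
      ContinuousOn (F m) (Ioi 0) →
      (∀ x ∈ Ioi (0 : ℝ), ∀ y ∈ Ioi (0 : ℝ), |F 0 x - F 0 y| ≤ √x + √y + √|x - y|) →
      (∀ a b, 0 < a → a ≤ b → ∫ t in a..b, t ^ (2 * σ) * F m t ^ 2 ≤ 1) →
      ∀ b, 1 ≤ b →
        ∫ t in (1 : ℝ)..b, t ^ (2 * σ + 1 - m / j) * |F j t| ^ (2 * (m : ℝ) / j) ≤ K := by
  obtain ⟨K, hK, hstep⟩ := exists_right_step m j hj hjm σ
  have hr : 0 < 2 * (m : ℝ) - 2 - 2 * σ := by linarith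
  refine ⟨K * (1 + 1 / (2 * (m : ℝ) - 2 - 2 * σ)), by positivity, fun F hF hc hosc hA b hb => ?_⟩
  have hstep := hstep F hF hc hosc
  set w : ℝ → ℝ := fun t => t ^ (2 * σ + 1 - m / j) * |F j t| ^ (2 * (m : ℝ) / j)
  have hwc : ContinuousOn w (Ioi 0) := continuousOn_rpow_mul_abs_rpow (by positivity)
    fun t ht => (hF j hjm t ht).continuousAt.continuousWithinAt
  have hgc : ContinuousOn (fun t => t ^ (2 * σ) * F m t ^ 2) (Ioi 0) := by
    simpa using continuousOn_rpow_mul_abs_rpow (q := 2 * σ) two_pos.le hc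
  have hpc : ContinuousOn (fun t : ℝ => t ^ (2 * σ + 1 - 2 * (m : ℝ))) (Ioi 0) := fun t ht =>
    (Real.continuousAt_rpow_const t _ (Or.inl (ne_of_gt ht))).continuousWithinAt
  have hii : ∀ {u : ℝ → ℝ}, ContinuousOn u (Ioi 0) → ∀ {x y : ℝ}, 0 < x → 0 < y →
      IntervalIntegrable u volume x y := fun hu x y hx hy =>
    (hu.mono ((convex_Ioi 0).ordConnected.uIcc_subset hx hy)).intervalIntegrable
  have hpr : ∀ {u : ℝ → ℝ}, ContinuousOn u (Ioi 0) →
      ContinuousOn (fun y => ∫ t in (1 : ℝ)..y, u t) (Ici 1) := by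
    intro u hu y hy
    have h1 : ContinuousOn (fun y => ∫ t in (1 : ℝ)..y, u t) (uIcc 1 (y + 1)) := by
      refine intervalIntegral.continuousOn_primitive_interval ?_
      rw [uIcc_of_le (by linarith [mem_Ici.1 hy])]
      exact (hu.mono (Icc_subset_Ioi_zero one_pos)).integrableOn_Icc
    rw [uIcc_of_le (by linarith [mem_Ici.1 hy])] at h1
    have h2 := h1 y ⟨hy, by linarith⟩
    refine h2.mono_of_mem_nhdsWithin ?_
    rw [← Ici_inter_Iic]
    exact Filter.inter_mem self_mem_nhdsWithin
      (mem_nhdsWithin_of_mem_nhds (Iic_mem_nhds (by linarith)))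
  set Ψ : ℝ → ℝ := fun y => K * ((∫ t in (1 : ℝ)..y, t ^ (2 * σ) * F m t ^ 2) +
    ∫ t in (1 : ℝ)..y, t ^ (2 * σ + 1 - 2 * (m : ℝ))) - ∫ t in (1 : ℝ)..y, w t with hΨ
  have hΨc : ContinuousOn Ψ (Ici 1) :=
    (continuousOn_const.mul ((hpr hgc).add (hpr hpc))).sub (hpr hwc)
  obtain ⟨y, hy, hby, hΨy⟩ := exists_ge_of_forall_exists_gt hΨc (fun x hx => by
    have hx0 : 0 < x := one_pos.trans_le hx
    obtain ⟨y, hxy, h⟩ := hstep x hx0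
    refine ⟨y, hxy, ?_⟩
    have hy0 := hx0.trans hxy
    simp only [hΨ]
    rw [← intervalIntegral.integral_add_adjacent_intervals (hii hgc one_pos hx0) (hii hgc hx0 hy0),
      ← intervalIntegral.integral_add_adjacent_intervals (hii hpc one_pos hx0) (hii hpc hx0 hy0),
      ← intervalIntegral.integral_add_adjacent_intervals (hii hwc one_pos hx0) (hii hwc hx0 hy0)]
    linarith) b
  have hy0 : 0 < y := one_pos.trans_le hy
  have hΨ1 : Ψ 1 = 0 := by simp [hΨ]
  rw [hΨ1] at hΨy
  have hpow : ∫ t in (1 : ℝ)..y, t ^ (2 * σ + 1 - 2 * (m : ℝ)) ≤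
      1 / (2 * (m : ℝ) - 2 - 2 * σ) := by
    rw [integral_rpow (Or.inr ⟨by linarith, fun h => by
      rw [uIcc_of_le hy] at h; linarith [h.1]⟩), Real.one_rpow, ← neg_div_neg_eq]
    rw [show -(2 * σ + 1 - 2 * (m : ℝ) + 1) = 2 * (m : ℝ) - 2 - 2 * σ by ring]
    gcongr
    linarith [Real.rpow_nonneg hy0.le (2 * σ + 1 - 2 * (m : ℝ) + 1)]
  calc ∫ t in (1 : ℝ)..b, w t ≤ ∫ t in (1 : ℝ)..y, w t := by
        refine intervalIntegral.integral_mono_interval le_rfl hb hby ?_ (hii hwc one_pos hy0)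
        refine (ae_restrict_mem measurableSet_Ioc).mono fun t ht => ?_
        have : 0 < t := one_pos.trans ht.1
        simp only [w, Pi.zero_apply]; positivity
    _ ≤ K * ((∫ t in (1 : ℝ)..y, t ^ (2 * σ) * F m t ^ 2) +
          ∫ t in (1 : ℝ)..y, t ^ (2 * σ + 1 - 2 * (m : ℝ))) := sub_nonneg.1 hΨy
    _ ≤ _ := by gcongr; exact hA 1 y one_pos hy

theorem integral_rpow_sub_one_le {x s : ℝ} (hx : 0 < x) (hx1 : x ≤ 1) (hs : s < 0) :
    ∫ t in x..1, t ^ (s - 1) ≤ x ^ s / (-s) := by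
  rw [integral_rpow (Or.inr ⟨by linarith, fun h => by
    rw [uIcc_of_le hx1] at h; linarith [h.1]⟩), Real.one_rpow, sub_add_cancel, ← neg_div_neg_eq]
  have : 0 < -s := by linarith
  gcongr
  linarith

theorem exists_abs_deriv_one_le (m k : ℕ) (hk : 1 ≤ k) (hkm : k < m) (σ : ℝ) :
    ∃ C : ℝ, 0 ≤ C ∧ ∀ F : ℕ → ℝ → ℝ,
      (∀ k < m, ∀ x ∈ Ioi (0 : ℝ), HasDerivAt (F k) (F (k + 1) x) x) →
      ContinuousOn (F m) (Ioi 0) →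
      (∀ x ∈ Ioi (0 : ℝ), ∀ y ∈ Ioi (0 : ℝ), |F 0 x - F 0 y| ≤ √x + √y + √|x - y|) →
      (∀ a b, 0 < a → a ≤ b → ∫ t in a..b, t ^ (2 * σ) * F m t ^ 2 ≤ 1) → |F k 1| ≤ C := by
  obtain ⟨C, hC, hloc⟩ := abs_intermediate_deriv_mul_pow_le m k hk hkm
  set s : ℝ := √(2 ^ |2 * σ|)
  have hs : 0 < s := Real.sqrt_pos.2 (by positivity)
  have hs2 : s ^ 2 = 2 ^ |2 * σ| := Real.sq_sqrt (by positivity)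
  refine ⟨C * (5 + 2 * s), by positivity, fun F hF hc hosc hA => ?_⟩
  have hsub : Icc (1 : ℝ) (1 + 1) ⊆ Ioi 0 := Icc_subset_Ioi_zero one_pos
  have h1 := rpow_mul_integral_le (2 * σ) one_pos zero_le_one le_rfl
    ((hc.pow 2).mono hsub) fun t _ => sq_nonneg (F m t)
  rw [Real.one_rpow, one_mul] at h1
  have h2 : (∫ t in (1 : ℝ)..(1 + 1), F m t ^ 2) * 1 ^ (2 * m - 1) ≤ s ^ 2 := by
    rw [one_pow, mul_one, hs2]
    exact h1.trans (mul_le_of_le_one_right (by positivity) (hA 1 (1 + 1) one_pos (by norm_num)))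
  have h3 := integral_abs_mul_pow_le (by omega) one_pos hs (hc.mono hsub) h2
  have := hloc F 1 1 (5 + 2 * s) one_pos (fun k hk t ht => hF k hk t (hsub ht)) (hc.mono hsub)
    (fun x hx y hy => ?_) (h3.trans (by linarith)) 1 ⟨le_rfl, by norm_num⟩
  · simpa using this
  · have h4 : √x ≤ 2 := Real.sqrt_le_iff.2 ⟨by norm_num, by linarith [hx.2]⟩
    have h5 : √y ≤ 2 := Real.sqrt_le_iff.2 ⟨by norm_num, by linarith [hy.2]⟩
    have h6 : √|x - y| ≤ 1 := Real.sqrt_le_iff.2 ⟨by norm_num, by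
      rw [abs_le]; constructor <;> linarith [hx.1, hy.1, hx.2, hy.2]⟩
    linarith [hosc x (hsub hx) y (hsub hy)]

theorem exists_abs_deriv_le_rpow (m k d : ℕ) (hk : 1 ≤ k) (hd : k + d + 1 = m) (σ ε : ℝ)
    (hε : 0 < ε) :
    ∃ C : ℝ, 0 ≤ C ∧ ∀ F : ℕ → ℝ → ℝ,
      (∀ k < m, ∀ x ∈ Ioi (0 : ℝ), HasDerivAt (F k) (F (k + 1) x) x) →
      ContinuousOn (F m) (Ioi 0) →
      (∀ x ∈ Ioi (0 : ℝ), ∀ y ∈ Ioi (0 : ℝ), |F 0 x - F 0 y| ≤ √x + √y + √|x - y|) →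
      (∀ a b, 0 < a → a ≤ b → ∫ t in a..b, t ^ (2 * σ) * F m t ^ 2 ≤ 1) →
      ∀ x, 0 < x → x ≤ 1 → |F k x| ≤ C * x ^ min (m - σ - 1 / 2 - k) (-ε) := by
  induction d generalizing k with
  | zero =>
    obtain ⟨C, hC, h1⟩ := exists_abs_deriv_one_le m k hk (by omega) σ
    set s : ℝ := min (m - σ - 1 / 2 - k) (-ε)
    have hs : s < 0 := (min_le_right _ _).trans_lt (by linarith)
    have hs' : 0 < -s := by linarith
    have hs2 : 2 * s - 1 ≤ -(2 * σ) := by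
      have : s ≤ m - σ - 1 / 2 - k := min_le_left _ _
      have hm : (m : ℝ) = k + 1 := by exact_mod_cast hd.symm
      linarith
    refine ⟨C + 1 + 1 / (-(2 * s)), by have : 0 < -(2 * s) := by linarith
                                       positivity, fun F hF hc hosc hA x hx hx1 => ?_⟩
    have hsub : Icc x 1 ⊆ Ioi 0 := Icc_subset_Ioi_zero hx
    have hkm : k + 1 = m := hd
    have h2 := abs_sub_le_intervalIntegral_abs hx1 (fun t ht => hF k (by omega) t (hsub ht))
      (by rw [hkm]; exact hc.mono hsub) (right_mem_Icc.2 hx1) (left_mem_Icc.2 hx1)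
    rw [hkm] at h2
    have hxs : 1 ≤ x ^ s := Real.one_le_rpow_of_pos_of_le_one_of_nonpos hx hx1 hs.le
    have hgi : IntervalIntegrable (fun t => t ^ (2 * σ) * F m t ^ 2) volume x 1 := by
      refine ContinuousOn.intervalIntegrable_of_Icc hx1 ?_
      simpa using (continuousOn_rpow_mul_abs_rpow (q := 2 * σ) two_pos.le hc).mono hsub
    have hpi : IntervalIntegrable (fun t : ℝ => t ^ (2 * s - 1)) volume x 1 :=
      ContinuousOn.intervalIntegrable_of_Icc hx1 fun t ht =>
        (Real.continuousAt_rpow_const t _ (Or.inl (ne_of_gt (hsub ht)))).continuousWithinAt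
    have h3 : ∫ t in x..1, |F m t| ≤
        ∫ t in x..1, (x ^ s * (t ^ (2 * σ) * F m t ^ 2) + x ^ (-s) * t ^ (2 * s - 1)) := by
      refine intervalIntegral.integral_mono_on hx1
        ((hc.mono hsub).abs.intervalIntegrable_of_Icc hx1)
        ((hgi.const_mul _).add (hpi.const_mul _)) fun t ht => ?_
      have ht0 : 0 < t := hsub ht
      have h4 : t ^ (-(2 * σ)) ≤ t ^ (2 * s - 1) :=
        Real.rpow_le_rpow_of_exponent_ge ht0 ht.2 hs2
      have h5 : |F m t| ≤ x ^ s * (t ^ (2 * σ) * F m t ^ 2) + x ^ (-s) * t ^ (-(2 * σ)) := by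
        rw [Real.rpow_neg hx.le, Real.rpow_neg ht0.le, ← sq_abs, ← mul_assoc, ← mul_inv]
        have hp : 0 < x ^ s * t ^ (2 * σ) := by positivity
        generalize x ^ s * t ^ (2 * σ) = c at hp ⊢
        have h6 : 0 ≤ (c * |F m t| - 1) ^ 2 + c * |F m t| := by positivity
        have h7 : c * |F m t| ≤ c * (c * |F m t| ^ 2 + c⁻¹) := by
          rw [mul_add, mul_inv_cancel₀ hp.ne']; nlinarith
        exact le_of_mul_le_mul_left h7 hp
      exact h5.trans (by gcongr)
    rw [intervalIntegral.integral_add (hgi.const_mul _) (hpi.const_mul _),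
      intervalIntegral.integral_const_mul, intervalIntegral.integral_const_mul] at h3
    have h8 := integral_rpow_sub_one_le hx hx1 (by linarith : 2 * s < 0)
    have h9 : x ^ (-s) * (x ^ (2 * s) / (-(2 * s))) = 1 / (-(2 * s)) * x ^ s := by
      rw [← mul_div_assoc, ← Real.rpow_add hx, show -s + 2 * s = s by ring]; ring
    have h10 : |F k x| ≤ |F k x - F k 1| + |F k 1| := by
      simpa using abs_add_le (F k x - F k 1) (F k 1)
    calc |F k x| ≤ (x ^ s * 1 + x ^ (-s) * (x ^ (2 * s) / (-(2 * s)))) + C * x ^ s := by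
          refine h10.trans (add_le_add (h2.trans (h3.trans ?_)) ?_)
          · gcongr
            exact hA x 1 hx hx1
          · exact (h1 F hF hc hosc hA).trans (le_mul_of_one_le_right hC hxs)
      _ = _ := by rw [h9]; ring
  | succ d ih =>
    obtain ⟨C, hC, h1⟩ := exists_abs_deriv_one_le m k hk (by omega) σ
    obtain ⟨C', hC', ih⟩ := ih (k + 1) (by omega) (by omega)
    set s : ℝ := min (m - σ - 1 / 2 - k) (-ε)
    set s' : ℝ := min (m - σ - 1 / 2 - (k + 1 : ℕ)) (-ε)
    have hs : s < 0 := (min_le_right _ _).trans_lt (by linarith)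
    have hs' : 0 < -s := by linarith
    have hs2 : s - 1 ≤ s' := by
      have e1 : s ≤ m - σ - 1 / 2 - k := min_le_left _ _
      have e2 : s ≤ -ε := min_le_right _ _
      refine le_min ?_ (by linarith)
      push_cast; linarith
    refine ⟨C + C' / (-s), by positivity, fun F hF hc hosc hA x hx hx1 => ?_⟩
    have hsub : Icc x 1 ⊆ Ioi 0 := Icc_subset_Ioi_zero hx
    have hk1 : ContinuousOn (F (k + 1)) (Icc x 1) := fun t ht =>
      (hF (k + 1) (by omega) t (hsub ht)).continuousAt.continuousWithinAt
    have h2 := abs_sub_le_intervalIntegral_abs hx1 (fun t ht => hF k (by omega) t (hsub ht))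
      hk1 (right_mem_Icc.2 hx1) (left_mem_Icc.2 hx1)
    have hxs : 1 ≤ x ^ s := Real.one_le_rpow_of_pos_of_le_one_of_nonpos hx hx1 hs.le
    have hpi : IntervalIntegrable (fun t : ℝ => t ^ (s - 1)) volume x 1 :=
      ContinuousOn.intervalIntegrable_of_Icc hx1 fun t ht =>
        (Real.continuousAt_rpow_const t _ (Or.inl (ne_of_gt (hsub ht)))).continuousWithinAt
    have h3 : ∫ t in x..1, |F (k + 1) t| ≤ ∫ t in x..1, C' * t ^ (s - 1) := by
      refine intervalIntegral.integral_mono_on hx1 (hk1.abs.intervalIntegrable_of_Icc hx1)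
        (hpi.const_mul _) fun t ht => ?_
      refine (ih F hF hc hosc hA t (hsub ht) ht.2).trans ?_
      exact mul_le_mul_of_nonneg_left (Real.rpow_le_rpow_of_exponent_ge (hsub ht) ht.2 hs2) hC'
    rw [intervalIntegral.integral_const_mul] at h3
    have h8 := integral_rpow_sub_one_le hx hx1 hs
    have h10 : |F k x| ≤ |F k x - F k 1| + |F k 1| := by
      simpa using abs_add_le (F k x - F k 1) (F k 1)
    calc |F k x| ≤ C' * (x ^ s / (-s)) + C * x ^ s := by
          refine h10.trans (add_le_add (h2.trans (h3.trans ?_)) ?_)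
          · exact mul_le_mul_of_nonneg_left h8 hC'
          · exact (h1 F hF hc hosc hA).trans (le_mul_of_one_le_right hC hxs)
      _ = _ := by ring

theorem exists_left_bound (m j : ℕ) (hj : 1 ≤ j) (hjm : j < m) (σ : ℝ)
    (hσ : ((m : ℝ) - 2) / 2 < σ) (hσ' : σ < m - 1) :
    ∃ K : ℝ, 0 ≤ K ∧ ∀ F : ℕ → ℝ → ℝ,
      (∀ k < m, ∀ x ∈ Ioi (0 : ℝ), HasDerivAt (F k) (F (k + 1) x) x) →
      ContinuousOn (F m) (Ioi 0) →
      (∀ x ∈ Ioi (0 : ℝ), ∀ y ∈ Ioi (0 : ℝ), |F 0 x - F 0 y| ≤ √x + √y + √|x - y|) →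
      (∀ a b, 0 < a → a ≤ b → ∫ t in a..b, t ^ (2 * σ) * F m t ^ 2 ≤ 1) →
      ∀ a, 0 < a → a ≤ 1 →
        ∫ t in a..1, t ^ (2 * σ + 1 - m / j) * |F j t| ^ (2 * (m : ℝ) / j) ≤ K := by
  have hj1 : (1 : ℝ) ≤ j := by exact_mod_cast hj
  have hj0 : (0 : ℝ) < j := by linarith
  have hjm' : (j : ℝ) < m := by exact_mod_cast hjm
  have hm0 : (0 : ℝ) < m := hj0.trans hjm'
  set ε : ℝ := (σ + 1 - m / 2) / (2 * m) with hε
  have hε0 : 0 < ε := by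
    have : 0 < σ + 1 - m / 2 := by linarith
    positivity
  obtain ⟨d, hd⟩ := Nat.exists_eq_add_of_lt hjm
  obtain ⟨C, hC, hb⟩ := exists_abs_deriv_le_rpow m j d hj hd.symm σ ε hε0
  set s : ℝ := min (m - σ - 1 / 2 - j) (-ε) with hs
  set q : ℝ := 2 * σ + 1 - m / j with hq
  set p : ℝ := 2 * (m : ℝ) / j with hp
  have hp0 : 0 < p := by positivity
  have hr : 0 < q + s * p + 1 := by
    rcases min_choice ((m : ℝ) - σ - 1 / 2 - j) (-ε) with h | h
    · have e : q + s * p + 1 = (2 * ((m : ℝ) - 1 - σ)) * (m / j - 1) := by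
        rw [hs, h, hq, hp]; field_simp; ring
      rw [e]
      exact mul_pos (by linarith) (sub_pos.2 ((one_lt_div hj0).2 hjm'))
    · have e : q + s * p + 1 = ((σ + 1) * (2 * j - 1) - m / 2) / j := by
        rw [hs, h, hq, hp, hε]; field_simp; ring
      rw [e]
      refine div_pos ?_ hj0
      nlinarith
  refine ⟨C ^ p * (1 / (q + s * p + 1)), by positivity, fun F hF hc hosc hA a ha ha1 => ?_⟩
  have hsub : Icc a 1 ⊆ Ioi 0 := Icc_subset_Ioi_zero ha
  have hwc : ContinuousOn (fun t => t ^ q * |F j t| ^ p) (Ioi 0) :=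
    continuousOn_rpow_mul_abs_rpow hp0.le
      fun t ht => (hF j hjm t ht).continuousAt.continuousWithinAt
  have hpi : IntervalIntegrable (fun t : ℝ => t ^ (q + s * p)) volume a 1 :=
    ContinuousOn.intervalIntegrable_of_Icc ha1 fun t ht =>
      (Real.continuousAt_rpow_const t _ (Or.inl (ne_of_gt (hsub ht)))).continuousWithinAt
  have h1 : ∫ t in a..1, t ^ q * |F j t| ^ p ≤ ∫ t in a..1, C ^ p * t ^ (q + s * p) := by
    refine intervalIntegral.integral_mono_on ha1 ((hwc.mono hsub).intervalIntegrable_of_Icc ha1)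
      (hpi.const_mul _) fun t ht => ?_
    have ht0 : 0 < t := hsub ht
    calc t ^ q * |F j t| ^ p ≤ t ^ q * (C * t ^ s) ^ p := by
          gcongr
          exact hb F hF hc hosc hA t ht0 ht.2
      _ = C ^ p * t ^ (q + s * p) := by
          rw [Real.mul_rpow hC (by positivity), Real.rpow_add ht0, Real.rpow_mul ht0.le]; ring
  rw [intervalIntegral.integral_const_mul, integral_rpow (Or.inl (by linarith)),
    Real.one_rpow] at h1
  refine h1.trans ?_
  gcongr
  linarith [Real.rpow_nonneg ha.le (q + s * p + 1)]

theorem exists_integral_bound_of_normalized (m j : ℕ) (hj : 1 ≤ j) (hjm : j < m) (σ : ℝ)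
    (hσ : ((m : ℝ) - 2) / 2 < σ) (hσ' : σ < m - 1) :
    ∃ K : ℝ, 0 ≤ K ∧ ∀ F : ℕ → ℝ → ℝ,
      (∀ k < m, ∀ x ∈ Ioi (0 : ℝ), HasDerivAt (F k) (F (k + 1) x) x) →
      ContinuousOn (F m) (Ioi 0) →
      (∀ x ∈ Ioi (0 : ℝ), ∀ y ∈ Ioi (0 : ℝ), |F 0 x - F 0 y| ≤ √x + √y + √|x - y|) →
      (∀ a b, 0 < a → a ≤ b → ∫ t in a..b, t ^ (2 * σ) * F m t ^ 2 ≤ 1) →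
      ∀ a b, 0 < a → a ≤ b →
        ∫ t in a..b, t ^ (2 * σ + 1 - m / j) * |F j t| ^ (2 * (m : ℝ) / j) ≤ K := by
  obtain ⟨K₁, hK₁, h₁⟩ := exists_left_bound m j hj hjm σ hσ hσ'
  obtain ⟨K₂, hK₂, h₂⟩ := exists_right_bound m j hj hjm σ hσ'
  refine ⟨K₁ + K₂, by positivity, fun F hF hc hosc hA a b ha hab => ?_⟩
  have hwc : ContinuousOn (fun t => t ^ (2 * σ + 1 - m / j) * |F j t| ^ (2 * (m : ℝ) / j))
      (Ioi 0) := continuousOn_rpow_mul_abs_rpow (by positivity)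
        fun t ht => (hF j hjm t ht).continuousAt.continuousWithinAt
  have hii : ∀ {x y : ℝ}, 0 < x → 0 < y → IntervalIntegrable
      (fun t => t ^ (2 * σ + 1 - m / j) * |F j t| ^ (2 * (m : ℝ) / j)) volume x y :=
    fun hx hy => (hwc.mono ((convex_Ioi 0).ordConnected.uIcc_subset hx hy)).intervalIntegrable
  have ha' : 0 < min a 1 := lt_min ha one_pos
  have hb' : 0 < max b 1 := one_pos.trans_le (le_max_right _ _)
  have h3 := h₁ F hF hc hosc hA (min a 1) ha' (min_le_right _ _)
  have h4 := h₂ F hF hc hosc hA (max b 1) (le_max_right _ _)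
  have h5 := intervalIntegral.integral_add_adjacent_intervals
    (hii ha' one_pos) (hii one_pos hb')
  refine le_trans ?_ (h5.symm.trans_le (add_le_add h3 h4))
  refine intervalIntegral.integral_mono_interval (min_le_left _ _) hab (le_max_left _ _) ?_
    (hii ha' hb')
  refine (ae_restrict_mem measurableSet_Ioc).mono fun t ht => ?_
  have : 0 < t := ha'.trans ht.1
  simp only [Pi.zero_apply]
  positivity

theorem exists_integral_bound (m j : ℕ) (hj : 1 ≤ j) (hjm : j < m) (σ : ℝ)
    (hσ : ((m : ℝ) - 2) / 2 < σ) (hσ' : σ < m - 1) :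
    ∃ K : ℝ, 0 ≤ K ∧ ∀ (F : ℕ → ℝ → ℝ) (H A : ℝ), 0 < H → 0 < A →
      (∀ k < m, ∀ x ∈ Ioi (0 : ℝ), HasDerivAt (F k) (F (k + 1) x) x) →
      ContinuousOn (F m) (Ioi 0) →
      (∀ x ∈ Ioi (0 : ℝ), ∀ y ∈ Ioi (0 : ℝ), |F 0 x - F 0 y| ≤ H * (√x + √y + √|x - y|)) →
      (∀ a b, 0 < a → a ≤ b → ∫ t in a..b, t ^ (2 * σ) * F m t ^ 2 ≤ A ^ 2) →
      ∀ a b, 0 < a → a ≤ b →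
        ∫ t in a..b, t ^ (2 * σ + 1 - m / j) * |F j t| ^ (2 * (m : ℝ) / j) ≤
          K * (H ^ (2 * (m : ℝ) / j - 2) * A ^ 2) := by
  obtain ⟨K, hK, h⟩ := exists_integral_bound_of_normalized m j hj hjm σ hσ hσ'
  refine ⟨K, hK, fun F H A hH hA hF hc hosc hFA a b ha hab => ?_⟩
  have hj0 : (0 : ℝ) < j := by exact_mod_cast hj
  set p : ℝ := 2 * (m : ℝ) / j with hp
  set q : ℝ := 2 * σ + 1 - m / j with hq
  have hν : 0 < 2 * (m : ℝ) - 2 - 2 * σ := by linarith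
  set c : ℝ := (H ^ 2 / A ^ 2) ^ (1 / (2 * (m : ℝ) - 2 - 2 * σ)) with hc_def
  have hc0 : 0 < c := by positivity
  have hcν : c ^ (2 * (m : ℝ) - 2 - 2 * σ) = H ^ 2 / A ^ 2 := by
    rw [hc_def, ← Real.rpow_mul (by positivity), one_div_mul_cancel hν.ne', Real.rpow_one]
  have hmem : ∀ {x : ℝ}, 0 < x → 0 < c * x := fun hx => mul_pos hc0 hx
  set G : ℕ → ℝ → ℝ := fun k x => c ^ k * F k (c * x) / (H * √c) with hG
  have hsc : 0 < √c := Real.sqrt_pos.2 hc0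
  have hsc2 : √c ^ 2 = c := Real.sq_sqrt hc0.le
  have key := h G ?_ ?_ ?_ ?_ (a / c) (b / c) (by positivity) (by gcongr)
  · have e : ∀ t ∈ uIcc (a / c) (b / c), t ^ q * |G j t| ^ p =
        (c ^ (2 * (m : ℝ) - m / j - q) / H ^ p) * ((c * t) ^ q * |F j (c * t)| ^ p) := by
      intro t ht
      rw [uIcc_of_le (by gcongr)] at ht
      have ht0 : 0 < t := (by positivity : 0 < a / c).trans_le ht.1
      have e1 : (c ^ j) ^ p = c ^ (2 * (m : ℝ)) := by
        rw [← Real.rpow_natCast c j, ← Real.rpow_mul hc0.le, hp]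
        congr 1; field_simp
      have e2 : √c ^ p = c ^ ((m : ℝ) / j) := by
        rw [Real.sqrt_eq_rpow, ← Real.rpow_mul hc0.le, hp]
        congr 1; field_simp
      simp only [hG]
      rw [abs_div, abs_mul, abs_of_pos (by positivity : 0 < c ^ j),
        abs_of_pos (by positivity : 0 < H * √c), Real.div_rpow (by positivity) (by positivity),
        Real.mul_rpow (by positivity) (by positivity), Real.mul_rpow hH.le hsc.le, e1, e2,
        Real.mul_rpow hc0.le ht0.le, Real.rpow_sub hc0, Real.rpow_sub hc0]
      field_simp
    rw [intervalIntegral.integral_congr e, intervalIntegral.integral_const_mul,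
      intervalIntegral.integral_comp_mul_left (fun t => t ^ q * |F j t| ^ p) hc0.ne',
      mul_div_cancel₀ _ hc0.ne', mul_div_cancel₀ _ hc0.ne', smul_eq_mul, ← mul_assoc] at key
    have e3 : c ^ (2 * (m : ℝ) - m / j - q) / H ^ p * c⁻¹ = (H ^ (p - 2) * A ^ 2)⁻¹ := by
      have e4 : c ^ (2 * (m : ℝ) - m / j - q) * c⁻¹ = H ^ 2 / A ^ 2 := by
        rw [← hcν, ← Real.rpow_neg_one, ← Real.rpow_add hc0, hq]
        congr 1; ring
      rw [div_mul_eq_mul_div, e4, Real.rpow_sub hH, Real.rpow_two]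
      field_simp
    rwa [e3, inv_mul_le_iff₀ (by positivity), mul_comm] at key
  · intro k hk x hx
    have h1 := (hF k hk (c * x) (hmem hx)).comp x ((hasDerivAt_id x).const_mul c)
    refine ((h1.const_mul (c ^ k)).div_const (H * √c)).congr_deriv ?_
    simp only [hG]; ring
  · refine ContinuousOn.div_const (continuousOn_const.mul ?_) _
    exact hc.comp (by fun_prop) fun x hx => hmem hx
  · intro x hx y hy
    have h1 := hosc (c * x) (hmem hx) (c * y) (hmem hy)
    rw [← mul_sub, abs_mul, abs_of_pos hc0, Real.sqrt_mul hc0.le, Real.sqrt_mul hc0.le,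
      Real.sqrt_mul hc0.le] at h1
    simp only [hG, pow_zero, one_mul]
    rw [← sub_div, abs_div, abs_of_pos (by positivity : 0 < H * √c), div_le_iff₀ (by positivity)]
    linarith
  · intro a b ha hab
    have e : ∀ t ∈ uIcc a b, t ^ (2 * σ) * G m t ^ 2 =
        (c ^ (2 * (m : ℝ) - 1 - 2 * σ) / H ^ 2) * ((c * t) ^ (2 * σ) * F m (c * t) ^ 2) := by
      intro t ht
      rw [uIcc_of_le hab] at ht
      have ht0 : 0 < t := ha.trans_le ht.1
      have e1 : c ^ (2 * (m : ℝ)) = (c ^ m) ^ 2 := by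
        rw [← Real.rpow_natCast c m, ← Real.rpow_mul_natCast hc0.le]
        congr 1; push_cast; ring
      simp only [hG]
      rw [div_pow, mul_pow, mul_pow, hsc2, Real.mul_rpow hc0.le ht0.le, Real.rpow_sub hc0,
        Real.rpow_sub hc0, Real.rpow_one, e1]
      field_simp
    rw [intervalIntegral.integral_congr e, intervalIntegral.integral_const_mul,
      intervalIntegral.integral_comp_mul_left (fun t => t ^ (2 * σ) * F m t ^ 2) hc0.ne',
      smul_eq_mul, ← mul_assoc]
    have e3 : c ^ (2 * (m : ℝ) - 1 - 2 * σ) / H ^ 2 * c⁻¹ = (A ^ 2)⁻¹ := by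
      have e4 : c ^ (2 * (m : ℝ) - 1 - 2 * σ) * c⁻¹ = H ^ 2 / A ^ 2 := by
        rw [← hcν, ← Real.rpow_neg_one, ← Real.rpow_add hc0]
        congr 1; ring
      rw [div_mul_eq_mul_div, e4]
      field_simp
    rw [e3, inv_mul_le_iff₀ (by positivity), mul_one]
    exact hFA _ _ (hmem ha) (by gcongr)

theorem wLp_eq_lintegral_rpow {σ r : ℝ} (hr : 0 < r) (u : ℝ → ℝ) :
    wLp σ (ENNReal.ofReal r) u =
      (∫⁻ t in Ioi 0, ENNReal.ofReal (t ^ (σ * r) * |u t| ^ r)) ^ (1 / r) := by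
  rw [wLp, eLpNorm_eq_lintegral_rpow_enorm_toReal (by simpa using hr) ENNReal.ofReal_ne_top,
    ENNReal.toReal_ofReal hr.le]
  congr 1
  refine setLIntegral_congr_fun measurableSet_Ioi fun t ht => ?_
  have ht0 : 0 < t := ht
  rw [Real.enorm_eq_ofReal_abs, ENNReal.ofReal_rpow_of_nonneg (abs_nonneg _) hr.le, abs_mul,
    Real.mul_rpow (abs_nonneg _) (abs_nonneg _), abs_of_pos (by positivity : 0 < t ^ σ),
    Real.rpow_mul ht0.le]

theorem ofReal_intervalIntegral_eq_setLIntegral {u : ℝ → ℝ} {a b : ℝ}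
    (hu : ContinuousOn u (Ioi 0)) (hn : ∀ t ∈ Ioi (0 : ℝ), 0 ≤ u t) (ha : 0 < a) (hab : a ≤ b) :
    ENNReal.ofReal (∫ t in a..b, u t) = ∫⁻ t in Ioc a b, ENNReal.ofReal (u t) := by
  rw [intervalIntegral.integral_of_le hab]
  refine ofReal_integral_eq_lintegral_ofReal ?_ ?_
  · exact ((hu.mono (Icc_subset_Ioi_zero ha)).integrableOn_Icc).mono_set Ioc_subset_Icc_self
  · exact (ae_restrict_mem measurableSet_Ioc).mono fun t ht => hn t (ha.trans ht.1)

theorem setLIntegral_Ioi_le_of_intervalIntegral_le {u : ℝ → ℝ} {B : ℝ}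
    (hu : ContinuousOn u (Ioi 0)) (hn : ∀ t ∈ Ioi (0 : ℝ), 0 ≤ u t)
    (h : ∀ a b, 0 < a → a ≤ b → ∫ t in a..b, u t ≤ B) :
    ∫⁻ t in Ioi 0, ENNReal.ofReal (u t) ≤ ENNReal.ofReal B := by
  have hU : Ioi (0 : ℝ) = ⋃ n : ℕ, Ioc (1 / ((n : ℝ) + 1)) ((n : ℝ) + 1) := by
    ext t
    simp only [mem_Ioi, mem_iUnion, mem_Ioc]
    constructor
    · intro ht
      obtain ⟨n, hn⟩ := exists_nat_one_div_lt ht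
      obtain ⟨k, hk⟩ := exists_nat_ge t
      refine ⟨max n k, lt_of_le_of_lt ?_ hn, ?_⟩
      · gcongr; exact le_max_left _ _
      · have : (k : ℝ) ≤ (max n k : ℕ) := by exact_mod_cast le_max_right _ _
        linarith
    · rintro ⟨n, hn, -⟩
      exact lt_trans (by positivity) hn
  rw [hU, setLIntegral_iUnion_of_directed]
  · refine iSup_le fun n => ?_
    have hle : 1 / ((n : ℝ) + 1) ≤ n + 1 := by
      rw [div_le_iff₀ (by positivity)]
      nlinarith [(Nat.cast_nonneg n : (0 : ℝ) ≤ n)]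
    rw [← ofReal_intervalIntegral_eq_setLIntegral hu hn (by positivity) hle]
    exact ENNReal.ofReal_le_ofReal (h _ _ (by positivity) hle)
  · refine directed_of_isDirected_le fun i k hik => Ioc_subset_Ioc ?_ ?_
    · gcongr
    · gcongr

theorem exists_wLp_le (m j : ℕ) (hj : 1 ≤ j) (hjm : j < m) (σ : ℝ)
    (hσ : ((m : ℝ) - 2) / 2 < σ) (hσ' : σ < m - 1) :
    ∃ C : ℝ, 0 ≤ C ∧ ∀ f : ℝ → ℝ, ContDiffOn ℝ m f (Ioi 0) → ∀ H : ℝ, 0 ≤ H →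
      (∀ x ∈ Ioi (0 : ℝ), ∀ y ∈ Ioi (0 : ℝ), |f x - f y| ≤ H * (√x + √y + √|x - y|)) →
      wLp σ 2 (iteratedDeriv m f) < ⊤ →
      wLp (σ * ((j : ℝ) / m) - (1 - (j : ℝ) / m) / 2) (ENNReal.ofReal (2 * (m : ℝ) / j))
          (iteratedDeriv j f) ≤
        ENNReal.ofReal C * ENNReal.ofReal H ^ (1 - (j : ℝ) / m) *
          wLp σ 2 (iteratedDeriv m f) ^ ((j : ℝ) / m) := by
  obtain ⟨K, hK, hb⟩ := exists_integral_bound m j hj hjm σ hσ hσ'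
  have hj0 : (0 : ℝ) < j := by exact_mod_cast hj
  have hjm' : (j : ℝ) < m := by exact_mod_cast hjm
  have hm0 : (0 : ℝ) < m := hj0.trans hjm'
  set p : ℝ := 2 * (m : ℝ) / j with hp
  have hp0 : 0 < p := by positivity
  have hθ : 0 < 1 - (j : ℝ) / m := sub_pos.2 ((div_lt_one hm0).2 hjm')
  have hθ' : 0 < (j : ℝ) / m := by positivity
  refine ⟨K ^ (1 / p), by positivity, fun f hf H hH hosc hfin => ?_⟩
  set A : ℝ := (wLp σ 2 (iteratedDeriv m f)).toReal with hA
  have hA0 : 0 ≤ A := ENNReal.toReal_nonneg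
  have hwA : wLp σ 2 (iteratedDeriv m f) = ENNReal.ofReal A :=
    (ENNReal.ofReal_toReal hfin.ne).symm
  have hopen : ∀ k, EqOn (iteratedDerivWithin k f (Ioi 0)) (iteratedDeriv k f) (Ioi 0) :=
    fun k => iteratedDerivWithin_of_isOpen isOpen_Ioi
  have hud : UniqueDiffOn ℝ (Ioi (0 : ℝ)) := isOpen_Ioi.uniqueDiffOn
  have hd : ∀ k < m, ∀ x ∈ Ioi (0 : ℝ),
      HasDerivAt (iteratedDeriv k f) (iteratedDeriv (k + 1) f x) x := by
    intro k hk x hx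
    have h1 : DifferentiableOn ℝ (iteratedDeriv k f) (Ioi 0) :=
      (hf.differentiableOn_iteratedDerivWithin (by exact_mod_cast hk) hud).congr
        fun x hx => (hopen k hx).symm
    rw [iteratedDeriv_succ]
    exact (h1.differentiableAt (Ioi_mem_nhds hx)).hasDerivAt
  have hc : ContinuousOn (iteratedDeriv m f) (Ioi 0) :=
    (hf.continuousOn_iteratedDerivWithin le_rfl hud).congr fun x hx => (hopen m hx).symm
  have hgc : ContinuousOn (fun t => t ^ (2 * σ) * iteratedDeriv m f t ^ 2) (Ioi 0) := by
    simpa using continuousOn_rpow_mul_abs_rpow (q := 2 * σ) two_pos.le hc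
  have hgn : ∀ t ∈ Ioi (0 : ℝ), 0 ≤ t ^ (2 * σ) * iteratedDeriv m f t ^ 2 := fun t ht => by
    have : 0 < t := ht
    positivity
  have hintegral : ∀ a b, 0 < a → a ≤ b →
      ∫ t in a..b, t ^ (2 * σ) * iteratedDeriv m f t ^ 2 ≤ A ^ 2 := by
    intro a b ha hab
    rw [← ENNReal.ofReal_le_ofReal_iff (by positivity),
      ofReal_intervalIntegral_eq_setLIntegral hgc hgn ha hab, ENNReal.ofReal_pow hA0, ← hwA,
      show (2 : ℝ≥0∞) = ENNReal.ofReal 2 by simp, wLp_eq_lintegral_rpow two_pos,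
      ← ENNReal.rpow_natCast, ← ENNReal.rpow_mul]
    norm_num
    rw [mul_comm σ 2]
    exact lintegral_mono_set fun t ht => ha.trans ht.1
  have hwc : ContinuousOn (fun t => t ^ (2 * σ + 1 - m / j) * |iteratedDeriv j f t| ^ p) (Ioi 0) :=
    continuousOn_rpow_mul_abs_rpow hp0.le
      fun t ht => (hd j hjm t ht).continuousAt.continuousWithinAt
  have hwn : ∀ t ∈ Ioi (0 : ℝ), 0 ≤ t ^ (2 * σ + 1 - m / j) * |iteratedDeriv j f t| ^ p :=
    fun t ht => by
      have : 0 < t := ht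
      positivity
  have hpos : ∀ δ : ℝ, 0 < δ →
      wLp (σ * ((j : ℝ) / m) - (1 - (j : ℝ) / m) / 2) (ENNReal.ofReal p) (iteratedDeriv j f) ≤
        ENNReal.ofReal (K ^ (1 / p) * ((H + δ) ^ (1 - (j : ℝ) / m) * (A + δ) ^ ((j : ℝ) / m))) := by
    intro δ hδ
    have hHδ : 0 < H + δ := by positivity
    have hAδ : 0 < A + δ := by positivity
    have h1 := setLIntegral_Ioi_le_of_intervalIntegral_le hwc hwn
      (hb (fun k => iteratedDeriv k f) (H + δ) (A + δ) hHδ hAδ hd hc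
        (fun x hx y hy => by
          simp only [iteratedDeriv_zero]
          exact (hosc x hx y hy).trans (by gcongr; linarith))
        (fun a b ha hab => (hintegral a b ha hab).trans (by gcongr; linarith)))
    rw [wLp_eq_lintegral_rpow hp0,
      show (σ * ((j : ℝ) / m) - (1 - (j : ℝ) / m) / 2) * p = 2 * σ + 1 - m / j by
        rw [hp]; field_simp; ring]
    refine (ENNReal.rpow_le_rpow h1 (by positivity)).trans_eq ?_
    rw [ENNReal.ofReal_rpow_of_nonneg (by positivity) (by positivity),
      Real.mul_rpow hK (by positivity), Real.mul_rpow (by positivity) (by positivity),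
      ← Real.rpow_mul hHδ.le, ← Real.rpow_natCast, ← Real.rpow_mul hAδ.le]
    congr 4
    · rw [hp]; field_simp
    · rw [hp]; push_cast; field_simp
  have hlim : Filter.Tendsto (fun δ : ℝ => ENNReal.ofReal
      (K ^ (1 / p) * ((H + δ) ^ (1 - (j : ℝ) / m) * (A + δ) ^ ((j : ℝ) / m))))
      (nhdsWithin 0 (Ioi 0)) (nhds (ENNReal.ofReal
        (K ^ (1 / p) * (H ^ (1 - (j : ℝ) / m) * A ^ ((j : ℝ) / m))))) := by
    have h1 : Continuous fun δ : ℝ => ENNReal.ofReal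
        (K ^ (1 / p) * ((H + δ) ^ (1 - (j : ℝ) / m) * (A + δ) ^ ((j : ℝ) / m))) :=
      ENNReal.continuous_ofReal.comp (continuous_const.mul
        (((continuous_const.add continuous_id).rpow_const fun _ => Or.inr hθ.le).mul
          ((continuous_const.add continuous_id).rpow_const fun _ => Or.inr hθ'.le)))
    simpa using (h1.tendsto 0).mono_left nhdsWithin_le_nhds
  refine (ge_of_tendsto hlim (Filter.eventually_of_mem self_mem_nhdsWithin hpos)).trans_eq ?_
  rw [hwA, ENNReal.ofReal_rpow_of_nonneg hH hθ.le, ENNReal.ofReal_rpow_of_nonneg hA0 hθ'.le,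
    ENNReal.ofReal_mul (by positivity), ENNReal.ofReal_mul (by positivity), mul_assoc]

/-- **Weighted interpolation against the adapted Hölder norm** (Proposition 2.16 in the
one-dimensional case): for `σ_m > (m-2)/2` with `m - 1 - σ_m > 0`, `θ_j = j/m`,
`σ_j = σ_m θ_j - (1-θ_j)/2`, `1/p_j = θ_j/2` (i.e. `p_j = 2m/j`):
`‖x^{σ_j} f^{(j)}‖_{L^{p_j}} ≤ C ‖f‖_{C̃^{0,1/2}}^{1-θ_j} ‖x^{σ_m} f^{(m)}‖_{L²}^{θ_j}`,
the adapted Hölder norm (with weight `r(x) = x`) being expressed through an arbitrary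
bound `H`. -/
theorem weighted_interpolation_adapted_holder_L2
    (m : ℕ) (hm : 2 ≤ m) (σm : ℝ) (hσm : ((m : ℝ) - 2) / 2 < σm)
    (hmain : 0 < (m : ℝ) - 1 - σm) :
    ∃ C : ℝ≥0∞, C ≠ ⊤ ∧ ∀ f : ℝ → ℝ, ContDiffOn ℝ m f (Set.Ioi 0) →
      ∀ H : ℝ, 0 ≤ H →
      (∀ x ∈ Set.Ioi (0:ℝ), ∀ y ∈ Set.Ioi (0:ℝ),
        |f x - f y| ≤ H * (Real.sqrt x + Real.sqrt y + Real.sqrt |x - y|)) →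
      wLp σm 2 (iteratedDeriv m f) < ⊤ →
      ∀ j : ℕ, 0 < j → j < m →
        wLp (σm * ((j : ℝ) / m) - (1 - (j : ℝ) / m) / 2)
            (ENNReal.ofReal (2 * (m : ℝ) / j))
            (iteratedDeriv j f)
          ≤ C * ENNReal.ofReal H ^ (1 - (j : ℝ) / m) *
              wLp σm 2 (iteratedDeriv m f) ^ ((j : ℝ) / m) := by
  choose! C hC h using fun j (hj : 1 ≤ j ∧ j < m) =>
    exists_wLp_le m j hj.1 hj.2 σm hσm (by linarith)
  refine ⟨ENNReal.ofReal (∑ j ∈ Finset.Ico 1 m, C j), ENNReal.ofReal_ne_top,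
    fun f hf H hH hosc hfin j hj hjm => ?_⟩
  refine (h j ⟨hj, hjm⟩ f hf H hH hosc hfin).trans ?_
  gcongr
  exact Finset.single_le_sum (f := C) (fun i hi => hC i (Finset.mem_Ico.1 hi))
    (Finset.mem_Ico.2 ⟨hj, hjm⟩)
end

section
/- Energy estimate for the linearized equation (the estimate of Proposition 3.1): Fix d ≥ 1, κ > 0. Let (r,v) be a solution of the free-boundary compressible Euler system on [0,T] with r, v continuously differentiable on [0,T]×ℝ^d, each Ω_t := {r(t,·) > 0} bounded, and r(t,·) a nondegenerate defining function of Ω_t, i.e. c·dist(x,∂Ω_t) ≤ r(t,x) ≤ C·dist(x,∂Ω_t) on Ω_t. Let (s,w), continuously differentiable on [0,T]×ℝ^d, solve the linearized system ∂_t s + v·∇s + w·∇r + κ( s ∇·v + r ∇·w ) = 0, ∂_t w + (v·∇)w + (w·∇)v + ∇s = 0 on Ω_t for each t ∈ [0,T]. Then the function t ↦ ‖(s,w)(t)‖²_H := ∫_{Ω_t} r(t,x)^{(1−κ)/κ} ( |s(t,x)|² + κ r(t,x) |w(t,x)|² ) dx is differentiable on [0,T] and | d/dt ‖(s,w)(t)‖²_H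 | ≤ K ‖∇v(t,·)‖_{L^∞(Ω_t)} ‖(s,w)(t)‖²_H for a constant K depending only on d and κ. -/
open MeasureTheory Set Metric

/-- The divergence `∇ · v` of a vector field on `ℝ^d`. -/
noncomputable def vdiv {d : ℕ}
    (v : EuclideanSpace ℝ (Fin d) → EuclideanSpace ℝ (Fin d))
    (x : EuclideanSpace ℝ (Fin d)) : ℝ :=
  ∑ i, @inner ℝ _ _ (fderiv ℝ v x (EuclideanSpace.single i 1)) (EuclideanSpace.single i 1)

/-- The weighted energy `‖(s,w)‖²_H = ∫_{Ω} r^{(1-κ)/κ}(|s|² + κ r |w|²) dx`,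
`Ω = {r > 0}`. -/
noncomputable def linEnergy {d : ℕ} (κ : ℝ)
    (r : EuclideanSpace ℝ (Fin d) → ℝ)
    (s : EuclideanSpace ℝ (Fin d) → ℝ)
    (w : EuclideanSpace ℝ (Fin d) → EuclideanSpace ℝ (Fin d)) : ℝ :=
  ∫ x in {x | 0 < r x}, (r x) ^ ((1 - κ) / κ) * ((s x) ^ 2 + κ * r x * ‖w x‖ ^ 2)

section SpaceTime

variable {E F : Type*} [NormedAddCommGroup E] [NormedSpace ℝ E]
  [NormedAddCommGroup F] [NormedSpace ℝ F] {f : ℝ → E → F}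

theorem fderiv_uncurry_apply (hf : ContDiff ℝ 1 (fun p : ℝ × E => f p.1 p.2))
    (t : ℝ) (x : E) (τ : ℝ) (u : E) :
    fderiv ℝ (fun p : ℝ × E => f p.1 p.2) (t, x) (τ, u) =
      τ • deriv (fun σ => f σ x) t + fderiv ℝ (f t) x u := by
  have hF := (hf.differentiable one_ne_zero (t, x)).hasFDerivAt
  have h1 : HasDerivAt (fun σ => f σ x)
      (fderiv ℝ (fun p : ℝ × E => f p.1 p.2) (t, x) (1, 0)) t :=
    hF.comp_hasDerivAt (f := fun σ => (σ, x)) t ((hasDerivAt_id t).prodMk (hasDerivAt_const t x))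
  have h2 : HasFDerivAt (f t) ((fderiv ℝ (fun p : ℝ × E => f p.1 p.2) (t, x)).comp
      (ContinuousLinearMap.inr ℝ ℝ E)) x :=
    hF.comp x (hasFDerivAt_prodMk_right t x)
  rw [h1.deriv, h2.fderiv, ← map_smul, ContinuousLinearMap.comp_apply, ← map_add]
  simp

theorem HasDerivWithinAt.spaceTime_comp (hf : ContDiff ℝ 1 (fun p : ℝ × E => f p.1 p.2))
    {X : ℝ → E} {X' : E} {S : Set ℝ} {t : ℝ} (hX : HasDerivWithinAt X X' S t) :
    HasDerivWithinAt (fun τ => f τ (X τ))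
      (deriv (fun σ => f σ (X t)) t + fderiv ℝ (f t) (X t) X') S t := by
  have hF := (hf.differentiable one_ne_zero (t, X t)).hasFDerivAt
  have := hF.comp_hasDerivWithinAt t ((hasDerivWithinAt_id t S).prodMk hX)
  rwa [fderiv_uncurry_apply hf, one_smul] at this

theorem continuous_deriv_time (hf : ContDiff ℝ 1 (fun p : ℝ × E => f p.1 p.2)) :
    Continuous (fun p : ℝ × E => deriv (fun σ => f σ p.2) p.1) := by
  have h : (fun p : ℝ × E => deriv (fun σ => f σ p.2) p.1) =
      fun p => fderiv ℝ (fun p : ℝ × E => f p.1 p.2) p (1, 0) := by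
    ext ⟨t, x⟩
    simp [fderiv_uncurry_apply hf]
  rw [h]
  exact (hf.continuous_fderiv one_ne_zero).clm_apply continuous_const

theorem continuous_fderiv_space (hf : ContDiff ℝ 1 (fun p : ℝ × E => f p.1 p.2)) :
    Continuous (fun p : ℝ × E => fderiv ℝ (f p.1) p.2) := by
  have h : (fun p : ℝ × E => fderiv ℝ (f p.1) p.2) =
      fun p => (fderiv ℝ (fun p : ℝ × E => f p.1 p.2) p).comp
        (ContinuousLinearMap.inr ℝ ℝ E) := by
    ext ⟨t, x⟩ u
    simp [fderiv_uncurry_apply hf]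
  rw [h]
  exact (hf.continuous_fderiv one_ne_zero).clm_comp continuous_const

theorem contDiff_slice (hf : ContDiff ℝ 1 (fun p : ℝ × E => f p.1 p.2)) (t : ℝ) :
    ContDiff ℝ 1 (f t) :=
  hf.comp (contDiff_const.prodMk contDiff_id)

theorem hasDerivAt_time (hf : ContDiff ℝ 1 (fun p : ℝ × E => f p.1 p.2)) (t : ℝ) (x : E) :
    HasDerivAt (fun σ => f σ x) (deriv (fun σ => f σ x) t) t :=
  ((hf.comp (contDiff_id.prodMk contDiff_const)).differentiable one_ne_zero t).hasDerivAt

theorem hasDerivAt_setIntegral_of_contDiff [MeasurableSpace E] [BorelSpace E]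
    [FiniteDimensional ℝ E] {μ : Measure E} [IsFiniteMeasureOnCompacts μ]
    (hf : ContDiff ℝ 1 (fun p : ℝ × E => f p.1 p.2)) {K : Set E} (hK : IsCompact K) (t : ℝ) :
    HasDerivAt (fun τ => ∫ x in K, f τ x ∂μ)
      (∫ x in K, deriv (fun σ => f σ x) t ∂μ) t := by
  have hc := continuous_deriv_time hf
  obtain ⟨M, hM⟩ := ((isCompact_closedBall t 1).prod hK).exists_bound_of_continuousOn
    hc.continuousOn
  refine (hasDerivAt_integral_of_dominated_loc_of_deriv_le (bound := fun _ => M)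
    (F' := fun τ x => deriv (fun σ => f σ x) τ)
    (closedBall_mem_nhds t one_pos) ?_ ?_ ?_ ?_ ?_ ?_).2
  · exact Filter.Eventually.of_forall fun τ =>
      (contDiff_slice hf τ).continuous.aestronglyMeasurable
  · exact ((contDiff_slice hf t).continuous.continuousOn).integrableOn_compact hK
  · exact (hc.comp (by fun_prop : Continuous fun x : E => (t, x))).aestronglyMeasurable
  · exact (ae_restrict_iff' hK.measurableSet).2
      (Filter.Eventually.of_forall fun x hx τ hτ => hM (τ, x) ⟨hτ, hx⟩)
  · exact continuousOn_const.integrableOn_compact hK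
  · exact Filter.Eventually.of_forall fun x τ _ => hasDerivAt_time hf τ x

end SpaceTime

theorem hasDerivWithinAt_Icc_of_uniform_approx {e D : ℝ → ℝ} {T : ℝ}
    (h : ∀ ω > 0, ∃ e' D' : ℝ → ℝ, (∀ t ∈ Icc 0 T, HasDerivAt e' (D' t) t) ∧ Continuous D' ∧
      ∀ t ∈ Icc 0 T, |e' t - e t| ≤ ω ∧ |D' t - D t| ≤ ω) {t : ℝ} (ht : t ∈ Icc 0 T) :
    HasDerivWithinAt e (D t) (Icc 0 T) t := by
  have hD : ContinuousOn D (Icc 0 T) := by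
    refine continuousOn_of_uniform_approx_of_continuousOn fun u hu => ?_
    obtain ⟨ε, hε, hεu⟩ := Metric.mem_uniformity_dist.1 hu
    obtain ⟨e', D', -, hc, hb⟩ := h (ε / 2) (by positivity)
    refine ⟨D', hc.continuousOn, fun y hy => hεu ?_⟩
    rw [dist_comm, Real.dist_eq]
    linarith [(hb y hy).2]
  rw [hasDerivWithinAt_iff_isLittleO, Asymptotics.isLittleO_iff]
  intro ε hε
  have hlim := hD t ht
  obtain ⟨δ, hδ, hδD⟩ := Metric.continuousWithinAt_iff.1 hlim (ε / 2) (by positivity)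
  filter_upwards [inter_mem_nhdsWithin (Icc 0 T) (Metric.ball_mem_nhds t hδ)] with y hy
  obtain ⟨hyT, hyδ⟩ := hy
  rw [Real.norm_eq_abs, smul_eq_mul]
  have key : ∀ ω > 0, |e y - e t - (y - t) * D t| ≤ ε / 2 * ‖y - t‖ + ω * (2 + |y - t|) := by
    intro ω hω
    obtain ⟨e', D', hd, hc, hb⟩ := h ω hω
    have hseg : uIcc t y ⊆ Icc 0 T := ordConnected_Icc.uIcc_subset ht hyT
    have := Convex.norm_image_sub_le_of_norm_hasDerivWithin_le
      (f := fun z => e' z - z * D t) (f' := fun z => D' z - D t) (s := uIcc t y)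
      (C := ε / 2 + ω) (x := t) (y := y)
      (fun z hz => by
        simpa using ((hd z (hseg hz)).fun_sub ((hasDerivAt_id z).mul_const (D t))).hasDerivWithinAt)
      (fun z hz => by
        have h1 := (hb z (hseg hz)).2
        have h2 : |D z - D t| < ε / 2 := hδD (hseg hz) (by
          have h3 := abs_sub_left_of_mem_uIcc hz
          rw [Real.dist_eq]
          exact h3.trans_lt (by simpa [Real.dist_eq] using hyδ))
        rw [Real.norm_eq_abs]
        calc |D' z - D t| ≤ |D' z - D z| + |D z - D t| := abs_sub_le _ _ _
          _ ≤ _ := by linarith)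
      (convex_uIcc t y) left_mem_uIcc right_mem_uIcc
    have h1 := (hb y hyT).1
    have h2 := (hb t ht).1
    rw [Real.norm_eq_abs, Real.norm_eq_abs] at this
    rw [Real.norm_eq_abs]
    rw [abs_le] at *
    constructor <;> nlinarith [this.1, this.2]
  have : |e y - e t - (y - t) * D t| ≤ ε / 2 * ‖y - t‖ := by
    refine le_of_forall_pos_le_add fun η hη => ?_
    have := key (η / (2 + |y - t|)) (by positivity)
    rwa [div_mul_cancel₀ _ (by positivity)] at this
  refine this.trans ?_
  gcongr
  linarith

section Divergence

variable {d : ℕ}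

theorem vdiv_eq_sum (u : EuclideanSpace ℝ (Fin d) → EuclideanSpace ℝ (Fin d))
    (x : EuclideanSpace ℝ (Fin d)) :
    vdiv u x = ∑ i, (fderiv ℝ u x (EuclideanSpace.single i 1)) i := by
  simp [vdiv, EuclideanSpace.inner_single_right]

theorem vdiv_smul {f : EuclideanSpace ℝ (Fin d) → ℝ}
    {u : EuclideanSpace ℝ (Fin d) → EuclideanSpace ℝ (Fin d)} {x : EuclideanSpace ℝ (Fin d)}
    (hf : DifferentiableAt ℝ f x) (hu : DifferentiableAt ℝ u x) :
    vdiv (fun y => f y • u y) x = f x * vdiv u x + fderiv ℝ f x (u x) := by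
  have hsum : u x = ∑ i, u x i • EuclideanSpace.single i (1 : ℝ) := by
    ext j
    simp [Finset.sum_apply, Pi.single_apply]
  rw [vdiv_eq_sum, vdiv_eq_sum, fderiv_fun_smul hf hu, Finset.mul_sum]
  conv_rhs => rw [hsum, map_sum]
  rw [← Finset.sum_add_distrib]
  refine Finset.sum_congr rfl fun i _ => ?_
  simp [mul_comm]

theorem abs_vdiv_le (u : EuclideanSpace ℝ (Fin d) → EuclideanSpace ℝ (Fin d))
    (x : EuclideanSpace ℝ (Fin d)) : |vdiv u x| ≤ d * ‖fderiv ℝ u x‖ := by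
  have h : ∀ i ∈ Finset.univ, |@inner ℝ _ _ (fderiv ℝ u x (EuclideanSpace.single i 1))
      (EuclideanSpace.single i (1 : ℝ))| ≤ ‖fderiv ℝ u x‖ := fun i _ => by
    refine (abs_real_inner_le_norm _ _).trans ?_
    simpa using (fderiv ℝ u x).le_opNorm (EuclideanSpace.single i (1 : ℝ))
  calc |vdiv u x| ≤ _ := Finset.abs_sum_le_sum_abs _ _
    _ ≤ _ := Finset.sum_le_sum h
    _ = _ := by simp

theorem integral_fderiv_apply_eq_zero {E : Type*} [NormedAddCommGroup E] [NormedSpace ℝ E]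
    [FiniteDimensional ℝ E] [MeasurableSpace E] [BorelSpace E] {μ : Measure E}
    [μ.IsAddHaarMeasure] {f : E → ℝ} (hf : ContDiff ℝ 1 f) (hc : HasCompactSupport f) (u : E) :
    ∫ x, fderiv ℝ f x u ∂μ = 0 := by
  have h1 : Integrable (fun x => fderiv ℝ f x u) μ :=
    ((hf.continuous_fderiv one_ne_zero).clm_apply continuous_const).integrable_of_hasCompactSupport
      (hc.fderiv_apply (𝕜 := ℝ) u)
  have h2 : Integrable f μ := hf.continuous.integrable_of_hasCompactSupport hc
  have := integral_mul_fderiv_eq_neg_fderiv_mul_of_integrable (𝕜 := ℝ) (μ := μ)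
    (f := fun _ : E => (1 : ℝ)) (g := f) (v := u)
    (by simp) (by simpa using h1) (by simpa using h2)
    (fun _ _ => differentiableAt_const _) (fun x _ => hf.differentiable one_ne_zero x)
  simpa using this

theorem integral_vdiv_eq_zero {u : EuclideanSpace ℝ (Fin d) → EuclideanSpace ℝ (Fin d)}
    (hu : ContDiff ℝ 1 u) (hc : HasCompactSupport u) :
    Integrable (vdiv u) ∧ ∫ x, vdiv u x = 0 := by
  have hcomp : ∀ i, ContDiff ℝ 1 (fun x => u x i) := fun i =>
    (EuclideanSpace.proj i : EuclideanSpace ℝ (Fin d) →L[ℝ] ℝ).contDiff.comp hu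
  have hcs : ∀ i, HasCompactSupport (fun x => u x i) := fun i =>
    hc.comp_left (g := fun y : EuclideanSpace ℝ (Fin d) => y i) (by simp)
  have hfd : ∀ i x, (fderiv ℝ u x (EuclideanSpace.single i 1)) i =
      fderiv ℝ (fun x => u x i) x (EuclideanSpace.single i 1) := fun i x => by
    have := ((EuclideanSpace.proj i : EuclideanSpace ℝ (Fin d) →L[ℝ] ℝ).hasFDerivAt.comp x
      (hu.differentiable one_ne_zero x).hasFDerivAt).fderiv
    have h2 : (fun x => u x i) = (EuclideanSpace.proj i : EuclideanSpace ℝ (Fin d) →L[ℝ] ℝ) ∘ u :=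
      rfl
    rw [h2, this]
    simp
  have hinteg : ∀ i ∈ Finset.univ, Integrable
      (fun x => fderiv ℝ (fun x => u x i) x (EuclideanSpace.single i 1)) := fun i _ =>
    (((hcomp i).continuous_fderiv one_ne_zero).clm_apply
      continuous_const).integrable_of_hasCompactSupport ((hcs i).fderiv_apply (𝕜 := ℝ) _)
  have heq : vdiv u = fun x => ∑ i, fderiv ℝ (fun x => u x i) x (EuclideanSpace.single i 1) := by
    ext x
    rw [vdiv_eq_sum]
    simp only [hfd]
  rw [heq]
  refine ⟨integrable_finsetSum _ hinteg, ?_⟩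
  rw [integral_finsetSum _ hinteg]
  exact Finset.sum_eq_zero fun i _ => integral_fderiv_apply_eq_zero (hcomp i) (hcs i) _


end Divergence

section CutPower

/-- A smooth truncation of the power `x ^ β`: it equals `x ^ β` for `x ≥ ε` and vanishes for
`x ≤ ε / 2`. -/
noncomputable def cutPow (β ε x : ℝ) : ℝ :=
  Real.smoothTransition (2 * x / ε - 1) * x ^ β

variable {β ε x : ℝ}

theorem cutPow_eq_zero (hε : 0 < ε) (hx : x ≤ ε / 2) : cutPow β ε x = 0 := by
  rw [cutPow, Real.smoothTransition.zero_of_nonpos, zero_mul]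
  rw [sub_nonpos, div_le_one hε]
  linarith

theorem cutPow_eq_rpow (hε : 0 < ε) (hx : ε ≤ x) : cutPow β ε x = x ^ β := by
  rw [cutPow, Real.smoothTransition.one_of_one_le, one_mul]
  have : 2 ≤ 2 * x / ε := by rw [le_div_iff₀ hε]; linarith
  linarith

theorem cutPow_nonneg (hε : 0 < ε) : 0 ≤ cutPow β ε x := by
  rcases le_or_gt x 0 with hx | hx
  · exact (cutPow_eq_zero hε (by linarith)).ge
  · exact mul_nonneg (Real.smoothTransition.nonneg _) (Real.rpow_nonneg hx.le _)

theorem cutPow_le_rpow (hx : 0 < x) : cutPow β ε x ≤ x ^ β :=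
  mul_le_of_le_one_left (Real.rpow_nonneg hx.le _) (Real.smoothTransition.le_one _)

theorem contDiff_cutPow (hε : 0 < ε) : ContDiff ℝ 1 (cutPow β ε) := by
  rw [contDiff_iff_contDiffAt]
  intro x
  rcases lt_or_ge x (ε / 2) with hx | hx
  · refine (contDiffAt_const (c := (0 : ℝ))).congr_of_eventuallyEq ?_
    filter_upwards [Iio_mem_nhds hx] with y hy using cutPow_eq_zero hε (le_of_lt hy)
  · refine ContDiffAt.mul ?_ (Real.contDiffAt_rpow_const_of_ne (by linarith))
    exact Real.smoothTransition.contDiffAt.comp x (by fun_prop)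

theorem deriv_smoothTransition_eq_zero_of_one_le {y : ℝ} (hy : 1 ≤ y) :
    deriv Real.smoothTransition y = 0 :=
  IsLocalMax.deriv_eq_zero <| Filter.Eventually.of_forall fun z => by
    rw [Real.smoothTransition.one_of_one_le hy]
    exact Real.smoothTransition.le_one z

theorem deriv_smoothTransition_eq_zero_of_nonpos {y : ℝ} (hy : y ≤ 0) :
    deriv Real.smoothTransition y = 0 :=
  IsLocalMin.deriv_eq_zero <| Filter.Eventually.of_forall fun z => by
    rw [Real.smoothTransition.zero_of_nonpos hy]
    exact Real.smoothTransition.nonneg z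

theorem exists_abs_deriv_smoothTransition_le :
    ∃ M, 0 ≤ M ∧ ∀ y, |deriv Real.smoothTransition y| ≤ M := by
  obtain ⟨M, hM⟩ := (isCompact_Icc (a := (0 : ℝ)) (b := 1)).exists_bound_of_continuousOn
    (Real.smoothTransition.contDiff (n := 1)).continuous_deriv_one.continuousOn
  have hM0 : 0 ≤ M := (norm_nonneg _).trans (hM 0 (by simp))
  refine ⟨M, hM0, fun y => ?_⟩
  rcases le_or_gt y 0 with h0 | h0
  · simpa [deriv_smoothTransition_eq_zero_of_nonpos h0] using hM0
  rcases le_or_gt 1 y with h1 | h1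
  · simpa [deriv_smoothTransition_eq_zero_of_one_le h1] using hM0
  · exact hM y ⟨h0.le, h1.le⟩

theorem deriv_cutPow_of_pos (hx : 0 < x) :
    deriv (cutPow β ε) x = deriv Real.smoothTransition (2 * x / ε - 1) * (2 / ε) * x ^ β +
      Real.smoothTransition (2 * x / ε - 1) * (β * x ^ (β - 1)) := by
  have h1 : HasDerivAt (fun x : ℝ => 2 * x / ε - 1) (2 / ε) x := by
    simpa using (((hasDerivAt_id x).const_mul 2).div_const ε).sub_const 1
  have h2 : HasDerivAt Real.smoothTransition _ (2 * x / ε - 1) :=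
    ((Real.smoothTransition.contDiff (n := 1)).differentiable one_ne_zero _).hasDerivAt
  exact ((h2.comp x h1).mul (Real.hasDerivAt_rpow_const (p := β) (Or.inl hx.ne'))).deriv

theorem deriv_cutPow_of_nonpos (hε : 0 < ε) (hx : x ≤ 0) : deriv (cutPow β ε) x = 0 := by
  have : cutPow β ε =ᶠ[nhds x] fun _ => 0 := by
    filter_upwards [Iio_mem_nhds (show x < ε / 2 by linarith)] with y hy
      using cutPow_eq_zero hε (le_of_lt hy)
  simpa using this.deriv_eq

theorem deriv_cutPow_nonneg (hβ : 0 ≤ β) (hε : 0 < ε) : 0 ≤ deriv (cutPow β ε) x := by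
  rcases le_or_gt x 0 with hx | hx
  · exact (deriv_cutPow_of_nonpos hε hx).ge
  · rw [deriv_cutPow_of_pos hx]
    have h1 := Real.smoothTransition.monotone.deriv_nonneg (x := 2 * x / ε - 1)
    have h2 := Real.smoothTransition.nonneg (2 * x / ε - 1)
    positivity

theorem deriv_cutPow_of_le (hε : 0 < ε) (hx : ε ≤ x) :
    deriv (cutPow β ε) x = β * x ^ (β - 1) := by
  have : 2 ≤ 2 * x / ε := by rw [le_div_iff₀ hε]; linarith
  rw [deriv_cutPow_of_pos (hε.trans_le hx), deriv_smoothTransition_eq_zero_of_one_le (by linarith),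
    Real.smoothTransition.one_of_one_le (by linarith)]
  ring

theorem mul_deriv_cutPow_of_pos (hx : 0 < x) :
    x * deriv (cutPow β ε) x = β * cutPow β ε x +
      2 * x / ε * deriv Real.smoothTransition (2 * x / ε - 1) * x ^ β := by
  rw [deriv_cutPow_of_pos hx, cutPow, Real.rpow_sub_one hx.ne']
  field_simp
  ring

end CutPower

section Nondegenerate

variable {E : Type*} [NormedAddCommGroup E] [NormedSpace ℝ E]

theorem HasDerivAt.le_of_forall_mul_le {g : ℝ → ℝ} {m k : ℝ} (hg : HasDerivAt g m 0)
    (h0 : g 0 ≤ 0) (h : ∀ τ ∈ Ioc (0 : ℝ) 1, k * τ ≤ g τ) : k ≤ m := by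
  refine ge_of_tendsto hg.tendsto_slope_zero_right ?_
  filter_upwards [Ioc_mem_nhdsGT (zero_lt_one (α := ℝ))] with τ hτ
  have := h τ hτ
  rw [smul_eq_mul, zero_add, ← div_eq_inv_mul, le_div_iff₀ hτ.1]
  linarith

/-- Near a positive value of a function comparable to the distance to the complement of its
positivity set, there is a boundary point at which the derivative is pinched between the two
comparison constants. -/
theorem exists_boundary_norm_fderiv_mem_Icc [ProperSpace E] {f : E → ℝ} (hf : Differentiable ℝ f)
    {c C : ℝ} (hc : 0 < c) (hcC : c ≤ C)
    (hbd : ∀ x, 0 < f x → c * infDist x {y | ¬ 0 < f y} ≤ f x ∧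
      f x ≤ C * infDist x {y | ¬ 0 < f y})
    (hne : {y | ¬ 0 < f y}.Nonempty) {x : E} (hx : 0 < f x) :
    ∃ y, dist x y ≤ f x / c ∧ ‖fderiv ℝ f y‖ ∈ Icc c C := by
  set S := {y | ¬ 0 < f y} with hS
  have hcl : IsClosed S := (isOpen_lt continuous_const hf.continuous).isClosed_compl
  obtain ⟨y, hyS, hxy⟩ := hcl.exists_infDist_eq_dist hne x
  have hh : 0 < dist x y := dist_pos.2 fun h => hyS (h ▸ hx)
  have hline : ∀ u : E, HasDerivAt (fun τ : ℝ => f (y + τ • u)) (fderiv ℝ f y u) 0 := fun u => by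
    have h1 : HasDerivAt (fun τ : ℝ => y + τ • u) u 0 := by
      simpa using ((hasDerivAt_id (0 : ℝ)).smul_const u).const_add y
    have h2 : HasFDerivAt f (fderiv ℝ f y) (y + (0 : ℝ) • u) := by
      simpa using (hf y).hasFDerivAt
    exact h2.comp_hasDerivAt (f := fun τ : ℝ => y + τ • u) 0 h1
  have hseg : ∀ τ ∈ Ioc (0 : ℝ) 1, 0 < f (y + τ • (x - y)) ∧
      c * dist x y * τ ≤ f (y + τ • (x - y)) := by
    intro τ hτ
    have hd : dist x (y + τ • (x - y)) = (1 - τ) * dist x y := by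
      rw [dist_eq_norm, dist_eq_norm, show x - (y + τ • (x - y)) = (1 - τ) • (x - y) by module,
        norm_smul, Real.norm_of_nonneg (by linarith [hτ.2])]
    have h1 : dist x y ≤ infDist (y + τ • (x - y)) S + (1 - τ) * dist x y := by
      rw [← hd, ← hxy]
      exact infDist_le_infDist_add_dist
    have h2 : τ * dist x y ≤ infDist (y + τ • (x - y)) S := by linarith
    have h3 : 0 < f (y + τ • (x - y)) := by
      by_contra hneg
      have := infDist_zero_of_mem (s := S) hneg
      rw [this] at h2
      exact absurd h2 (not_le.2 (mul_pos hτ.1 hh))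
    refine ⟨h3, le_trans ?_ (hbd _ h3).1⟩
    rw [mul_assoc, mul_comm (dist x y)]
    gcongr
  have hy0 : f y = 0 := by
    refine le_antisymm (not_lt.1 hyS) ?_
    have hcont : Filter.Tendsto (fun τ : ℝ => f (y + τ • (x - y))) (nhdsWithin 0 (Ioi 0))
        (nhds (f y)) := by
      have := (hline (x - y)).continuousAt.tendsto
      simp only [zero_smul, add_zero] at this
      exact this.mono_left nhdsWithin_le_nhds
    refine ge_of_tendsto hcont ?_
    filter_upwards [Ioc_mem_nhdsGT (zero_lt_one (α := ℝ))] with τ hτ using (hseg τ hτ).1.le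
  refine ⟨y, ?_, ?_, ?_⟩
  · rw [le_div_iff₀ hc, mul_comm, ← hxy]
    exact (hbd x hx).1
  · have h1 : c * dist x y ≤ fderiv ℝ f y (x - y) :=
      (hline (x - y)).le_of_forall_mul_le (by simp [hy0]) fun τ hτ => (hseg τ hτ).2
    have h2 := (le_abs_self _).trans ((fderiv ℝ f y).le_opNorm (x - y))
    rw [← dist_eq_norm] at h2
    exact le_of_mul_le_mul_right (h1.trans h2) hh
  · have hub : ∀ u, fderiv ℝ f y u ≤ C * ‖u‖ := by
      intro u
      refine le_of_tendsto (hline u).tendsto_slope_zero_right ?_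
      filter_upwards [Ioc_mem_nhdsGT (zero_lt_one (α := ℝ))] with τ hτ
      simp only [zero_add, zero_smul, add_zero, hy0, sub_zero, smul_eq_mul]
      rw [← div_eq_inv_mul, div_le_iff₀ hτ.1]
      rcases le_or_gt (f (y + τ • u)) 0 with hn | hp
      · exact hn.trans (mul_nonneg (mul_nonneg (hc.le.trans hcC) (norm_nonneg _)) hτ.1.le)
      · refine (hbd _ hp).2.trans ?_
        rw [mul_assoc]
        refine mul_le_mul_of_nonneg_left ?_ (hc.le.trans hcC)
        refine (infDist_le_dist_of_mem hyS).trans_eq ?_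
        rw [dist_eq_norm, add_sub_cancel_left, norm_smul, Real.norm_of_nonneg hτ.1.le, mul_comm]
    refine ContinuousLinearMap.opNorm_le_bound _ (hc.le.trans hcC) fun u => ?_
    rw [Real.norm_eq_abs, abs_le]
    have := hub (-u)
    rw [map_neg, norm_neg] at this
    exact ⟨by linarith, hub u⟩

end Nondegenerate

section BoundaryLayer

open scoped ENNReal

variable {E : Type*} [NormedAddCommGroup E] [NormedSpace ℝ E] [FiniteDimensional ℝ E]
  [MeasurableSpace E] [BorelSpace E] {μ : Measure E} [μ.IsAddHaarMeasure]

theorem setLIntegral_rpow_le_of_directional_deriv {f χ : E → ℝ} (hf : ContDiff ℝ 1 f)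
    (hχ : ContDiff ℝ 1 χ) (hχc : HasCompactSupport χ) (hχ0 : ∀ x, 0 ≤ χ x) {u : E}
    (hu : ‖u‖ ≤ 1) {k b m ε : ℝ} (hk : 0 < k) (hb : 0 < b) (hm : 0 ≤ m) (hε : 0 < ε)
    (hfm : ∀ x, 0 < f x → f x ≤ m) (hder : ∀ x, χ x ≠ 0 → k ≤ fderiv ℝ f x u) :
    ∫⁻ x in {x | χ x = 1 ∧ ε ≤ f x}, ENNReal.ofReal (f x ^ (b - 1)) ∂μ ≤
      ENNReal.ofReal (m ^ b / (k * b) * ∫ x, ‖fderiv ℝ χ x‖ ∂μ) := by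
  set P := cutPow b ε
  have hP : ContDiff ℝ 1 P := contDiff_cutPow hε
  have hPf : ContDiff ℝ 1 (fun x => P (f x)) := hP.comp hf
  have hPle : ∀ x, |P (f x)| ≤ m ^ b := fun x => by
    rw [abs_of_nonneg (cutPow_nonneg hε)]
    rcases le_or_gt (f x) 0 with h | h
    · rw [cutPow_eq_zero hε (by linarith)]
      positivity
    · exact (cutPow_le_rpow h).trans (Real.rpow_le_rpow h.le (hfm x h) hb.le)
  have hPd : ∀ x, fderiv ℝ (fun x => P (f x)) x u = deriv P (f x) * fderiv ℝ f x u := fun x => by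
    have := ((hP.differentiable one_ne_zero (f x)).hasDerivAt.comp_hasFDerivAt x
      (hf.differentiable one_ne_zero x).hasFDerivAt).fderiv
    change fderiv ℝ (P ∘ f) x u = _
    rw [this]
    simp
  set A : E → ℝ := fun x => χ x * (deriv P (f x) * fderiv ℝ f x u) with hA
  have hA0 : ∀ x, 0 ≤ A x := fun x => by
    rcases eq_or_ne (χ x) 0 with h | h
    · simp [hA, h]
    · exact mul_nonneg (hχ0 x) (mul_nonneg (deriv_cutPow_nonneg hb.le hε)
        (hk.le.trans (hder x h)))
  have hAc : Continuous A := hχ.continuous.mul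
    ((hP.continuous_deriv_one.comp hf.continuous).mul
      ((hf.continuous_fderiv one_ne_zero).clm_apply continuous_const))
  have hAint : Integrable A μ := hAc.integrable_of_hasCompactSupport hχc.mul_right
  have hparts : ∫ x, A x ∂μ = - ∫ x, fderiv ℝ χ x u * P (f x) ∂μ := by
    simp only [hA, ← hPd]
    refine integral_mul_fderiv_eq_neg_fderiv_mul_of_integrable ?_ ?_ ?_
      (fun x _ => hχ.differentiable one_ne_zero x) (fun x _ => hPf.differentiable one_ne_zero x)
    · exact (((hχ.continuous_fderiv one_ne_zero).clm_apply continuous_const).mul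
        hPf.continuous).integrable_of_hasCompactSupport (hχc.fderiv_apply (𝕜 := ℝ) u).mul_right
    · simp only [hPd]
      exact hAint
    · exact (hχ.continuous.mul hPf.continuous).integrable_of_hasCompactSupport hχc.mul_right
  have hle : ∫ x, A x ∂μ ≤ m ^ b * ∫ x, ‖fderiv ℝ χ x‖ ∂μ := by
    rw [hparts, ← integral_neg, ← integral_const_mul]
    have hinteg : Integrable (fun x => ‖fderiv ℝ χ x‖) μ :=
      ((hχ.continuous_fderiv one_ne_zero).integrable_of_hasCompactSupport
        (hχc.fderiv (𝕜 := ℝ))).norm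
    refine (Real.le_norm_self _).trans (norm_integral_le_of_norm_le (hinteg.const_mul _)
      (Filter.Eventually.of_forall fun x => ?_))
    rw [norm_neg, norm_mul, mul_comm]
    refine mul_le_mul (hPle x) ?_ (norm_nonneg _) (by positivity)
    exact ((fderiv ℝ χ x).le_opNorm u).trans (mul_le_of_le_one_right (norm_nonneg _) hu)
  have hmeas : MeasurableSet {x | χ x = 1 ∧ ε ≤ f x} :=
    ((isClosed_singleton.preimage hχ.continuous).inter
      (isClosed_le continuous_const hf.continuous)).measurableSet
  have hpt : ∀ x ∈ {x | χ x = 1 ∧ ε ≤ f x},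
      ENNReal.ofReal (f x ^ (b - 1)) ≤ ENNReal.ofReal ((k * b)⁻¹ * A x) := by
    rintro x ⟨hx1, hxε⟩
    refine ENNReal.ofReal_le_ofReal ?_
    have hd := hder x (by rw [hx1]; exact one_ne_zero)
    have hpow : 0 ≤ b * f x ^ (b - 1) := mul_nonneg hb.le (Real.rpow_nonneg (hε.le.trans hxε) _)
    rw [← div_eq_inv_mul, le_div_iff₀ (by positivity)]
    simp only [hA, hx1, one_mul]
    rw [show deriv P (f x) = b * f x ^ (b - 1) from deriv_cutPow_of_le hε hxε]
    nlinarith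
  calc _ ≤ ∫⁻ x in {x | χ x = 1 ∧ ε ≤ f x}, ENNReal.ofReal ((k * b)⁻¹ * A x) ∂μ :=
        setLIntegral_mono' hmeas hpt
    _ ≤ ∫⁻ x, ENNReal.ofReal ((k * b)⁻¹ * A x) ∂μ := setLIntegral_le_lintegral _ _
    _ = ENNReal.ofReal (∫ x, (k * b)⁻¹ * A x ∂μ) :=
        (ofReal_integral_eq_lintegral_ofReal (hAint.const_mul _)
          (Filter.Eventually.of_forall fun x => mul_nonneg (by positivity) (hA0 x))).symm
    _ ≤ _ := by
        refine ENNReal.ofReal_le_ofReal ?_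
        rw [integral_const_mul, div_mul_eq_mul_div, div_eq_inv_mul]
        gcongr

/-- Negative powers (of exponent `> -1`) of a nondegenerate defining function are integrable, with
a bound depending only on the nondegeneracy constant, the size of the domain, the supremum of the
function and the modulus of continuity of its derivative. -/
theorem exists_setLIntegral_rpow_le {R c ρ m b : ℝ} (hc : 0 < c) (hρ : 0 < ρ) (hρ1 : ρ ≤ 1)
    (hm : 0 ≤ m) (hb : 0 < b) :
    ∃ A : ℝ≥0∞, A ≠ ∞ ∧ ∀ f : E → ℝ, ContDiff ℝ 1 f →
      (∀ x, 0 < f x → x ∈ closedBall 0 R) → (∀ x, 0 < f x → f x ≤ m) →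
      (∀ x, 0 < f x → ∃ y, dist x y ≤ f x / c ∧ c ≤ ‖fderiv ℝ f y‖) →
      (∀ x ∈ closedBall (0 : E) (R + 1), ∀ y ∈ closedBall (0 : E) (R + 1), dist x y ≤ ρ →
        ‖fderiv ℝ f x - fderiv ℝ f y‖ ≤ c / 4) →
      ∫⁻ x in {x | 0 < f x}, ENNReal.ofReal (f x ^ (b - 1)) ∂μ ≤ A := by
  obtain ⟨s, hsK, hs, hcov⟩ := (isCompact_closedBall (0 : E) R).finite_cover_balls
    (show 0 < ρ / 4 by positivity)
  have : Finite s := hs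
  have : Fintype s := Fintype.ofFinite s
  let χ : ∀ a : s, ContDiffBump (a : E) := fun a =>
    ⟨ρ / 4, ρ / 2, by positivity, by linarith⟩
  set δ := c * ρ / 8 with hδ
  have hδ0 : 0 < δ := by positivity
  set B : s → ℝ≥0∞ := fun a =>
    ENNReal.ofReal (m ^ b / (c / 2 * b) * ∫ x, ‖fderiv ℝ (χ a) x‖ ∂μ)
  refine ⟨ENNReal.ofReal (δ ^ (b - 1) + m ^ (b - 1)) * μ (closedBall 0 R) + ∑ a, B a, ?_, ?_⟩
  · refine ENNReal.add_ne_top.2 ⟨ENNReal.mul_ne_top ENNReal.ofReal_ne_top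
      measure_closedBall_lt_top.ne, ?_⟩
    exact ENNReal.sum_ne_top.2 fun a _ => ENNReal.ofReal_ne_top
  intro f hf hR hfm hbdry hmod
  set g : E → ℝ≥0∞ := fun x => ENNReal.ofReal (f x ^ (b - 1))
  set L : s → ℕ → Set E := fun a n =>
    {x | x ∈ ball (a : E) (ρ / 4) ∧ f x < δ ∧ 1 / (n + 1 : ℝ) ≤ f x} with hL
  have hsub : {x | 0 < f x} ⊆ {x | δ ≤ f x} ∪ ⋃ a, ⋃ n, L a n := by
    intro x hx
    rcases le_or_gt δ (f x) with h | h
    · exact Or.inl h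
    · right
      obtain ⟨a, ha, hxa⟩ := mem_iUnion₂.1 (hcov (hR x hx))
      obtain ⟨n, hn⟩ := exists_nat_one_div_lt (show (0 : ℝ) < f x from hx)
      exact mem_iUnion.2 ⟨⟨a, ha⟩, mem_iUnion.2 ⟨n, hxa, h, hn.le⟩⟩
  have hfar : ∫⁻ x in {x | δ ≤ f x}, g x ∂μ ≤
      ENNReal.ofReal (δ ^ (b - 1) + m ^ (b - 1)) * μ (closedBall 0 R) := by
    have hmeas : MeasurableSet {x | δ ≤ f x} :=
      (isClosed_le continuous_const hf.continuous).measurableSet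
    calc _ ≤ ∫⁻ x in {x | δ ≤ f x}, ENNReal.ofReal (δ ^ (b - 1) + m ^ (b - 1)) ∂μ := by
          refine setLIntegral_mono' hmeas fun x hx => ENNReal.ofReal_le_ofReal ?_
          have hx0 : 0 < f x := hδ0.trans_le hx
          have hp1 : 0 ≤ δ ^ (b - 1) := by positivity
          have hp2 : 0 ≤ m ^ (b - 1) := by positivity
          rcases le_or_gt 1 b with h | h
          · have := Real.rpow_le_rpow hx0.le (hfm x hx0) (sub_nonneg.2 h)
            linarith
          · have := Real.rpow_le_rpow_of_nonpos hδ0 hx (sub_nonpos.2 h.le)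
            linarith
      _ = ENNReal.ofReal (δ ^ (b - 1) + m ^ (b - 1)) * μ {x | δ ≤ f x} := setLIntegral_const _ _
      _ ≤ _ := by
          gcongr
          exact fun x hx => hR x (hδ0.trans_le hx)
  have hnear : ∀ a n, ∫⁻ x in L a n, g x ∂μ ≤ B a := by
    intro a n
    rcases (L a n).eq_empty_or_nonempty with hemp | ⟨x, hxa, hxδ, hxn⟩
    · simp [hemp]
    have hx0 : 0 < f x := lt_of_lt_of_le (by positivity) hxn
    obtain ⟨y, hxy, hy⟩ := hbdry x hx0
    have hxy' : dist x y ≤ ρ / 8 := hxy.trans (by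
      rw [div_le_iff₀ hc]
      linarith)
    obtain ⟨u, hu1, hu2⟩ : ∃ u : E, ‖u‖ ≤ 1 ∧ 3 * c / 4 ≤ fderiv ℝ f y u := by
      obtain ⟨u, hu1, hu2⟩ := (fderiv ℝ f y).exists_lt_apply_of_lt_opNorm
        (show 3 * c / 4 < ‖fderiv ℝ f y‖ by linarith)
      rw [Real.norm_eq_abs] at hu2
      rcases lt_abs.1 hu2 with h | h
      · exact ⟨u, hu1.le, h.le⟩
      · exact ⟨-u, by rw [norm_neg]; exact hu1.le, by rw [map_neg]; exact h.le⟩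
    have hxR : dist x 0 ≤ R := hR x hx0
    have haR : dist (a : E) 0 ≤ R := hsK a.2
    have hder : ∀ z, χ a z ≠ 0 → c / 2 ≤ fderiv ℝ f z u := by
      intro z hz
      have hza : dist z a < ρ / 2 := by
        have : z ∈ Function.support (χ a) := hz
        rwa [(χ a).support_eq] at this
      have hax : dist x (a : E) < ρ / 4 := hxa
      have hzy : dist z y ≤ ρ := by
        have h1 := dist_triangle z a y
        have h2 := dist_triangle_left (a : E) y x
        linarith
      have hzR : z ∈ closedBall (0 : E) (R + 1) := by
        have := dist_triangle z a 0
        rw [mem_closedBall]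
        linarith
      have hyR : y ∈ closedBall (0 : E) (R + 1) := by
        have := dist_triangle_left y 0 x
        rw [mem_closedBall]
        linarith
      have h1 := hmod z hzR y hyR hzy
      have h2 := (fderiv ℝ f z - fderiv ℝ f y).le_opNorm u
      have h3 : |fderiv ℝ f z u - fderiv ℝ f y u| ≤ c / 4 :=
        (h2.trans (mul_le_of_le_one_right (norm_nonneg _) hu1)).trans h1
      linarith [(abs_le.1 h3).1]
    refine (lintegral_mono_set fun z hz => ?_).trans
      (setLIntegral_rpow_le_of_directional_deriv (k := c / 2) (ε := 1 / (n + 1 : ℝ)) hf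
        (χ a).contDiff (χ a).hasCompactSupport (fun _ => (χ a).nonneg) hu1 (by positivity) hb hm
        (by positivity) hfm hder)
    exact ⟨(χ a).one_of_mem_closedBall (ball_subset_closedBall hz.1), hz.2.2⟩
  have hlayer : ∀ a, ∫⁻ x in ⋃ n, L a n, g x ∂μ ≤ B a := by
    intro a
    rw [setLIntegral_iUnion_of_directed]
    · exact iSup_le (hnear a)
    · refine Monotone.directed_le fun n k hnk x hx => ⟨hx.1, hx.2.1, le_trans ?_ hx.2.2⟩
      gcongr
  calc _ ≤ ∫⁻ x in {x | δ ≤ f x} ∪ ⋃ a, ⋃ n, L a n, g x ∂μ := lintegral_mono_set hsub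
    _ ≤ ∫⁻ x in {x | δ ≤ f x}, g x ∂μ + ∫⁻ x in ⋃ a, ⋃ n, L a n, g x ∂μ :=
        lintegral_union_le _ _ _
    _ ≤ _ := by
        gcongr
        refine (lintegral_iUnion_le _ _).trans ?_
        rw [tsum_fintype]
        exact Finset.sum_le_sum fun a _ => hlayer a

end BoundaryLayer

section Trajectories

theorem exists_integral_curve_of_contDiff {E : Type*} [NormedAddCommGroup E]
    [InnerProductSpace ℝ E] [FiniteDimensional ℝ E] {v : ℝ → E → E}
    (hv : ContDiff ℝ 1 (fun p : ℝ × E => v p.1 p.2)) {T ρ : ℝ} (hρ : 0 < ρ) {t₁ : ℝ}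
    (ht₁ : t₁ ∈ Icc 0 T) (x₁ : E) :
    ∃ X : ℝ → E, X t₁ = x₁ ∧ ContinuousOn X (Icc 0 T) ∧ ∀ t ∈ Icc 0 T, ‖X t‖ ≤ ρ →
      HasDerivWithinAt X (v t (X t)) (Icc 0 T) t := by
  let χ : ContDiffBump (0 : E) := ⟨ρ, ρ + 1, hρ, by linarith⟩
  set V : ℝ → E → E := fun t x => χ x • v t x with hVdef
  have hV : ContDiff ℝ 1 (fun p : ℝ × E => V p.1 p.2) :=
    (χ.contDiff.comp contDiff_snd).smul hv
  have hT : 0 ≤ T := ht₁.1.trans ht₁.2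
  obtain ⟨M, hM⟩ := ((isCompact_Icc (a := 0) (b := T)).prod
    (isCompact_closedBall (0 : E) (ρ + 1))).exists_bound_of_continuousOn hV.continuous.continuousOn
  have hMV : ∀ t ∈ Icc 0 T, ∀ x, ‖V t x‖ ≤ M.toNNReal := by
    intro t ht x
    refine le_trans ?_ (Real.le_coe_toNNReal M)
    by_cases hx : x ∈ closedBall (0 : E) (ρ + 1)
    · exact hM (t, x) ⟨ht, hx⟩
    · have h0 : χ x = 0 := by
        have : x ∉ Function.support χ := by
          rw [χ.support_eq]
          exact fun h => hx (ball_subset_closedBall h)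
        simpa using this
      have hM0 : 0 ≤ M := (norm_nonneg _).trans
        (hM (t, 0) ⟨ht, mem_closedBall_self (by positivity)⟩)
      simpa [hVdef, h0] using hM0
  have hfd := continuous_fderiv_space hV
  obtain ⟨L, hL⟩ := ((isCompact_Icc (a := 0) (b := T)).prod
    (isCompact_closedBall x₁ (M.toNNReal * T.toNNReal))).exists_bound_of_continuousOn
    hfd.continuousOn
  have hPL : IsPicardLindelof V (⟨t₁, ht₁⟩ : Icc 0 T) x₁ (M.toNNReal * T.toNNReal) 0 M.toNNReal
      L.toNNReal := by
    refine ⟨fun t ht => ?_, fun x _ => ?_, fun t ht x _ => hMV t ht x, ?_⟩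
    · refine (convex_closedBall _ _).lipschitzOnWith_of_nnnorm_fderiv_le (𝕜 := ℝ)
        (fun x _ => (contDiff_slice hV t).differentiable one_ne_zero x) fun x hx => ?_
      rw [← NNReal.coe_le_coe, coe_nnnorm]
      exact (hL (t, x) ⟨ht, by simpa using hx⟩).trans (Real.le_coe_toNNReal L)
    · exact (hV.continuous.comp (by fun_prop : Continuous fun t : ℝ => (t, x))).continuousOn
    · have : max (T - t₁) (t₁ - 0) ≤ T := max_le (by linarith [ht₁.1]) (by linarith [ht₁.2])
      simp only [NNReal.coe_mul, NNReal.coe_zero, sub_zero, Real.coe_toNNReal T hT] at this ⊢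
      exact mul_le_mul_of_nonneg_left this (NNReal.coe_nonneg _)
  obtain ⟨X, hX0, hX⟩ := hPL.exists_eq_forall_mem_Icc_hasDerivWithinAt₀
  refine ⟨X, hX0, fun t ht => (hX t ht).continuousWithinAt, fun t ht hxt => ?_⟩
  have h1 : χ (X t) = 1 := χ.one_of_mem_closedBall (by simpa using hxt)
  simpa [hVdef, h1] using hX t ht

theorem hasDerivAt_max_zero_sq (x : ℝ) :
    HasDerivAt (fun y : ℝ => (max y 0) ^ 2) (2 * max x 0) x := by
  rcases lt_trichotomy x 0 with hx | rfl | hx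
  · rw [max_eq_right hx.le, mul_zero]
    refine (hasDerivAt_const x (0 : ℝ)).congr_of_eventuallyEq ?_
    filter_upwards [Iio_mem_nhds hx] with y hy
    simp [max_eq_right (le_of_lt (show y < 0 from hy))]
  · rw [hasDerivAt_iff_isLittleO_nhds_zero]
    refine Asymptotics.IsBigO.trans_isLittleO (g := fun h : ℝ => h ^ 2) ?_
      (Asymptotics.isLittleO_pow_id one_lt_two)
    refine Asymptotics.IsBigO.of_bound 1 (Filter.Eventually.of_forall fun h => ?_)
    simp only [zero_add, max_self, ne_eq, OfNat.ofNat_ne_zero, not_false_eq_true, zero_pow,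
      sub_zero, mul_zero, smul_eq_mul, norm_pow, one_mul]
    gcongr
    rw [Real.norm_eq_abs, Real.norm_eq_abs]
    rcases le_total h 0 with h0 | h0 <;> simp [h0]
  · rw [max_eq_left hx.le]
    have h := hasDerivAt_pow 2 x
    simp only [Nat.cast_ofNat, Nat.add_one_sub_one, pow_one] at h
    refine h.congr_of_eventuallyEq ?_
    filter_upwards [Ioi_mem_nhds hx] with y hy
    simp [max_eq_left (le_of_lt (show 0 < y from hy))]

/-- Two-sided backward Grönwall bound for a nonnegative solution of a scalar linear equation. -/
theorem exp_bounds_of_hasDerivWithinAt_mul {y β : ℝ → ℝ} {a b B : ℝ}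
    (hy : ∀ t ∈ Icc a b, HasDerivWithinAt y (β t * y t) (Icc a b) t)
    (hy0 : ∀ t ∈ Icc a b, 0 ≤ y t) (hβ : ∀ t ∈ Icc a b, |β t| ≤ B) {t : ℝ} (ht : t ∈ Icc a b) :
    y b * Real.exp (-(B * (b - t))) ≤ y t ∧ y t ≤ y b * Real.exp (B * (b - t)) := by
  have hb : b ∈ Icc a b := ⟨ht.1.trans ht.2, le_rfl⟩
  have hd : ∀ k, ∀ z ∈ Icc a b, HasDerivWithinAt (fun z => y z * Real.exp (k * z))
      ((β z + k) * (y z * Real.exp (k * z))) (Icc a b) z := fun k z hz => by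
    have h1 : HasDerivAt (fun z : ℝ => Real.exp (k * z)) (Real.exp (k * z) * k) z := by
      simpa using ((hasDerivAt_id z).const_mul k).exp
    exact ((hy z hz).fun_mul h1.hasDerivWithinAt).congr_deriv (by ring)
  have hmono : MonotoneOn (fun z => y z * Real.exp (B * z)) (Icc a b) := by
    refine monotoneOn_of_hasDerivWithinAt_nonneg (convex_Icc a b)
      (fun z hz => (hd B z hz).continuousWithinAt)
      (fun z hz => (hd B z (interior_subset hz)).mono interior_subset) fun z hz => ?_
    have h1 := (abs_le.1 (hβ z (interior_subset hz))).1
    exact mul_nonneg (by linarith) (mul_nonneg (hy0 z (interior_subset hz)) (Real.exp_pos _).le)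
  have hanti : AntitoneOn (fun z => y z * Real.exp (-B * z)) (Icc a b) := by
    refine antitoneOn_of_hasDerivWithinAt_nonpos (convex_Icc a b)
      (fun z hz => (hd (-B) z hz).continuousWithinAt)
      (fun z hz => (hd (-B) z (interior_subset hz)).mono interior_subset) fun z hz => ?_
    have h1 := (abs_le.1 (hβ z (interior_subset hz))).2
    exact mul_nonpos_of_nonpos_of_nonneg (by linarith)
      (mul_nonneg (hy0 z (interior_subset hz)) (Real.exp_pos _).le)
  have h1 := hmono ht hb ht.2
  have h2 := hanti ht hb ht.2
  simp only at h1 h2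
  constructor
  · rw [show -(B * (b - t)) = -B * b + B * t by ring, Real.exp_add, ← mul_assoc]
    calc y b * Real.exp (-B * b) * Real.exp (B * t)
        ≤ y t * Real.exp (-B * t) * Real.exp (B * t) := by gcongr
      _ = y t := by rw [mul_assoc, ← Real.exp_add]; simp
  · rw [show B * (b - t) = B * b + -B * t by ring, Real.exp_add, ← mul_assoc]
    calc y t = y t * Real.exp (B * t) * Real.exp (-B * t) := by
          rw [mul_assoc, ← Real.exp_add]; simp
      _ ≤ y b * Real.exp (B * b) * Real.exp (-B * t) := by gcongr

theorem exists_norm_ge_mem_Ioo {E : Type*} [NormedAddCommGroup E] [NormedSpace ℝ E]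
    [Nontrivial E] {f : E → ℝ} (hf : Continuous f) (hb : Bornology.IsBounded {x | 0 < f x}) {x : E}
    (hx : 0 < f x) {ε : ℝ} (hε : 0 < ε) : ∃ y, ‖x‖ ≤ ‖y‖ ∧ f y ∈ Ioo 0 ε := by
  obtain ⟨R, hR⟩ := hb.exists_norm_le
  have hxR : ‖x‖ ≤ R := hR x hx
  obtain ⟨e, he, hmono⟩ : ∃ e : E, e ≠ 0 ∧ ∀ h : ℝ, 0 ≤ h → ‖x‖ ≤ ‖x + h • e‖ := by
    rcases eq_or_ne x 0 with rfl | h0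
    · obtain ⟨e, he⟩ := exists_ne (0 : E)
      exact ⟨e, he, fun h _ => by simp⟩
    · refine ⟨x, h0, fun h hh => ?_⟩
      rw [show x + h • x = (1 + h) • x by module, norm_smul, Real.norm_of_nonneg (by linarith)]
      nlinarith [norm_nonneg x]
  have he0 : 0 < ‖e‖ := norm_pos_iff.2 he
  set H := (R + ‖x‖ + 1) / ‖e‖
  have hH : 0 ≤ H := by
    have := norm_nonneg x
    have : 0 ≤ R + ‖x‖ + 1 := by linarith
    positivity
  have hend : f (x + H • e) ≤ 0 := by
    by_contra hpos
    have h1 := hR _ (not_le.1 hpos)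
    have h2 : ‖H • e‖ = R + ‖x‖ + 1 := by
      rw [norm_smul, Real.norm_of_nonneg hH, div_mul_cancel₀ _ he0.ne']
    have h3 := norm_sub_le (x + H • e) x
    rw [add_sub_cancel_left] at h3
    linarith
  have hivt := intermediate_value_Icc' hH
    (f := fun h : ℝ => f (x + h • e)) (by fun_prop)
  have hmem : min (f x) (ε / 2) ∈ Icc (f (x + H • e)) (f (x + (0 : ℝ) • e)) := by
    refine ⟨hend.trans (le_min hx.le (by positivity)), ?_⟩
    simp
  obtain ⟨h, hh, heq⟩ := hivt hmem
  refine ⟨x + h • e, hmono h hh.1, ?_⟩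
  simp only at heq
  rw [heq]
  exact ⟨lt_min hx (by positivity), (min_le_right _ _).trans_lt (by linarith)⟩

theorem exists_uniform_modulus_fderiv {E : Type*} [NormedAddCommGroup E] [NormedSpace ℝ E]
    [FiniteDimensional ℝ E] {f : ℝ → E → ℝ} (hf : ContDiff ℝ 1 (fun p : ℝ × E => f p.1 p.2))
    (T R : ℝ) {ω : ℝ} (hω : 0 < ω) :
    ∃ η > 0, η ≤ 1 ∧ ∀ t ∈ Icc 0 T, ∀ x ∈ closedBall (0 : E) R, ∀ y ∈ closedBall (0 : E) R,
      dist x y ≤ η → ‖fderiv ℝ (f t) x - fderiv ℝ (f t) y‖ ≤ ω := by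
  have huc := ((isCompact_Icc (a := 0) (b := T)).prod
    (isCompact_closedBall (0 : E) R)).uniformContinuousOn_of_continuous
    (continuous_fderiv_space hf).continuousOn
  obtain ⟨δ, hδ, h⟩ := Metric.uniformContinuousOn_iff.1 huc ω hω
  refine ⟨min (δ / 2) 1, by positivity, min_le_right _ _, fun t ht x hx y hy hxy => ?_⟩
  rw [← dist_eq_norm]
  refine (h (t, x) ⟨ht, hx⟩ (t, y) ⟨ht, hy⟩ ?_).le
  rw [Prod.dist_eq, dist_self, max_eq_right dist_nonneg]
  exact hxy.trans_lt ((min_le_left _ _).trans_lt (by linarith))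

end Trajectories

section Confinement

variable {d : ℕ} {κ T : ℝ} {r : ℝ → EuclideanSpace ℝ (Fin d) → ℝ}
  {v : ℝ → EuclideanSpace ℝ (Fin d) → EuclideanSpace ℝ (Fin d)}

theorem norm_gradient_eq_norm_fderiv {E : Type*} [NormedAddCommGroup E] [InnerProductSpace ℝ E]
    [CompleteSpace E] (f : E → ℝ) (x : E) : ‖gradient f x‖ = ‖fderiv ℝ f x‖ := by
  simp [gradient]

/-- Along a particle path ending near the free boundary, the path stays in the moving domain and
the velocity varies by at most the elapsed time times a bound for `∇r` near the boundary. -/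
theorem pos_and_dist_le_along_trajectory
    (hr : ContDiff ℝ 1 (fun p : ℝ × EuclideanSpace ℝ (Fin d) => r p.1 p.2))
    (hv : ContDiff ℝ 1 (fun p : ℝ × EuclideanSpace ℝ (Fin d) => v p.1 p.2))
    (hmass : ∀ t ∈ Icc 0 T, ∀ x, 0 < r t x →
      deriv (fun τ => r τ x) t + @inner ℝ _ _ (v t x) (gradient (r t) x) +
        κ * r t x * vdiv (v t) x = 0)
    (hmom : ∀ t ∈ Icc 0 T, ∀ x, 0 < r t x →
      deriv (fun τ => v τ x) t + fderiv ℝ (v t) x (v t x) + gradient (r t) x = 0)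
    {X : ℝ → EuclideanSpace ℝ (Fin d)} {a b B ε A : ℝ} (hab : a ≤ b) (ha : 0 ≤ a) (hb : b ≤ T)
    (hX : ∀ t ∈ Icc a b, HasDerivWithinAt X (v t (X t)) (Icc a b) t)
    (hB : ∀ t ∈ Icc a b, |-2 * κ * vdiv (v t) (X t)| ≤ B) (hpos : 0 < r b (X b)) (hε : 0 < ε)
    (hsmall : r b (X b) ^ 2 * Real.exp (B * T) < ε ^ 2)
    (hA : ∀ t ∈ Icc a b, 0 < r t (X t) → r t (X t) < ε → ‖fderiv ℝ (r t) (X t)‖ ≤ A) :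
    0 < r a (X a) ∧ ∀ t ∈ Icc a b, dist (X a) (X b) ≤ (‖v t (X t)‖ + A * T) * T := by
  have hIcc : ∀ t ∈ Icc a b, t ∈ Icc 0 T := fun t ht => ⟨ha.trans ht.1, ht.2.trans hb⟩
  have hT : 0 ≤ T := ha.trans (hab.trans hb)
  have haI : a ∈ Icc a b := ⟨le_rfl, hab⟩
  have hbI : b ∈ Icc a b := ⟨hab, le_rfl⟩
  have hB0 : 0 ≤ B := (abs_nonneg _).trans (hB b hbI)
  have hq : ∀ t ∈ Icc a b, HasDerivWithinAt (fun t => (max (r t (X t)) 0) ^ 2)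
      (-2 * κ * vdiv (v t) (X t) * (max (r t (X t)) 0) ^ 2) (Icc a b) t := fun t ht => by
    refine ((hasDerivAt_max_zero_sq _).comp_hasDerivWithinAt t
      ((hX t ht).spaceTime_comp hr)).congr_deriv ?_
    rcases le_or_gt (r t (X t)) 0 with h | h
    · simp [max_eq_right h]
    · have := hmass t (hIcc t ht) _ h
      rw [inner_gradient_right, starRingEnd_apply, star_trivial] at this
      rw [max_eq_left h.le]
      linear_combination 2 * r t (X t) * this
  have hexp := fun t ht => exp_bounds_of_hasDerivWithinAt_mul hq (fun t _ => by positivity) hB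
    (t := t) ht
  simp only [max_eq_left hpos.le] at hexp
  have hposX : ∀ t ∈ Icc a b, 0 < r t (X t) := fun t ht => by
    by_contra h
    have h1 := (hexp t ht).1
    rw [max_eq_right (not_lt.1 h)] at h1
    have : 0 < r b (X b) ^ 2 * Real.exp (-(B * (b - t))) := by positivity
    norm_num at h1
    linarith
  have hlt : ∀ t ∈ Icc a b, r t (X t) < ε := fun t ht => by
    have h1 := (hexp t ht).2
    rw [max_eq_left (hposX t ht).le] at h1
    refine lt_of_pow_lt_pow_left₀ 2 hε.le (h1.trans_lt (lt_of_le_of_lt ?_ hsmall))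
    have : b - t ≤ T := by linarith [ha.trans ht.1]
    gcongr
  have hA0 : 0 ≤ A := (norm_nonneg _).trans (hA b hbI hpos (hlt b hbI))
  have hV : ∀ t ∈ Icc a b, HasDerivWithinAt (fun t => v t (X t)) (-gradient (r t) (X t))
      (Icc a b) t := fun t ht => by
    refine ((hX t ht).spaceTime_comp hv).congr_deriv ?_
    exact eq_neg_of_add_eq_zero_left (hmom t (hIcc t ht) _ (hposX t ht))
  have hVd : ∀ t ∈ Icc a b, ∀ t' ∈ Icc a b, ‖v t' (X t')‖ ≤ ‖v t (X t)‖ + A * T := by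
    intro t ht t' ht'
    have h1 := (convex_Icc a b).norm_image_sub_le_of_norm_hasDerivWithin_le hV
      (fun τ hτ => by
        rw [norm_neg, norm_gradient_eq_norm_fderiv]
        exact hA τ hτ (hposX τ hτ) (hlt τ hτ)) ht ht'
    have h2 : ‖t' - t‖ ≤ T := by
      rw [Real.norm_eq_abs, abs_le]
      constructor <;> linarith [ht.1, ht.2, ht'.1, ht'.2]
    have h3 := norm_le_insert' (v t' (X t')) (v t (X t))
    have h4 : A * ‖t' - t‖ ≤ A * T := by gcongr
    linarith
  refine ⟨hposX a haI, fun t ht => ?_⟩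
  have h1 := (convex_Icc a b).norm_image_sub_le_of_norm_hasDerivWithin_le hX
    (fun τ hτ => hVd t ht τ hτ) hbI haI
  rw [dist_eq_norm]
  refine h1.trans ?_
  have h2 : ‖a - b‖ ≤ T := by
    rw [Real.norm_eq_abs, abs_le]
    constructor <;> linarith
  gcongr

theorem nonempty_not_pos_of_isBounded {E : Type*} [NormedAddCommGroup E] [NormedSpace ℝ E]
    [Nontrivial E] {f : E → ℝ} (hb : Bornology.IsBounded {x | 0 < f x}) :
    {x | ¬ 0 < f x}.Nonempty := by
  by_contra h
  refine NormedSpace.unbounded_univ ℝ E (hb.subset fun x _ => ?_)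
  by_contra hx
  exact h ⟨x, hx⟩

/-- Near the free boundary of a nondegenerate domain, `∇r` is bounded by the nondegeneracy
constant. -/
theorem exists_norm_fderiv_le_of_lt
    [NeZero d] (hr : ContDiff ℝ 1 (fun p : ℝ × EuclideanSpace ℝ (Fin d) => r p.1 p.2))
    (hbdd : ∀ t ∈ Icc 0 T, Bornology.IsBounded {x | 0 < r t x}) {c C : ℝ} (hc : 0 < c)
    (hcC : c ≤ C) (hnd : ∀ t ∈ Icc 0 T, ∀ x, 0 < r t x →
      c * infDist x {y | ¬ 0 < r t y} ≤ r t x ∧ r t x ≤ C * infDist x {y | ¬ 0 < r t y})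
    (ρ : ℝ) :
    ∃ ε > 0, ∀ t ∈ Icc 0 T, ∀ x, ‖x‖ ≤ ρ → 0 < r t x → r t x < ε →
      ‖fderiv ℝ (r t) x‖ ≤ C + 1 := by
  obtain ⟨η, hη, hη1, h⟩ := exists_uniform_modulus_fderiv hr T (ρ + 1) one_pos
  refine ⟨c * η, by positivity, fun t ht x hx h0 hlt => ?_⟩
  obtain ⟨y, hxy, hy⟩ := exists_boundary_norm_fderiv_mem_Icc
    ((contDiff_slice hr t).differentiable one_ne_zero) hc hcC (hnd t ht)
    (nonempty_not_pos_of_isBounded (hbdd t ht)) h0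
  have hxyη : dist x y ≤ η := hxy.trans (by rw [div_le_iff₀ hc]; linarith)
  have hyρ : ‖y‖ ≤ ρ + 1 := by
    have := norm_le_insert x y
    rw [← dist_eq_norm] at this
    linarith
  have h1 := h t ht x (by simpa using hx.trans (by linarith)) y (by simpa using hyρ) hxyη
  have h2 := norm_le_insert' (fderiv ℝ (r t) x) (fderiv ℝ (r t) y)
  linarith [hy.2]

theorem continuous_vdiv_space {u : ℝ → EuclideanSpace ℝ (Fin d) → EuclideanSpace ℝ (Fin d)}
    (hu : ContDiff ℝ 1 (fun p : ℝ × EuclideanSpace ℝ (Fin d) => u p.1 p.2)) :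
    Continuous fun p : ℝ × EuclideanSpace ℝ (Fin d) => vdiv (u p.1) p.2 := by
  have := continuous_fderiv_space hu
  unfold vdiv
  fun_prop

/-- The moving domains of a `C¹` solution stay in a fixed ball. -/
theorem exists_norm_le_of_pos [NeZero d] (hT : 0 < T)
    (hr : ContDiff ℝ 1 (fun p : ℝ × EuclideanSpace ℝ (Fin d) => r p.1 p.2))
    (hv : ContDiff ℝ 1 (fun p : ℝ × EuclideanSpace ℝ (Fin d) => v p.1 p.2))
    (hbdd : ∀ t ∈ Icc 0 T, Bornology.IsBounded {x | 0 < r t x}) {c C : ℝ} (hc : 0 < c)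
    (hcC : c ≤ C) (hnd : ∀ t ∈ Icc 0 T, ∀ x, 0 < r t x →
      c * infDist x {y | ¬ 0 < r t y} ≤ r t x ∧ r t x ≤ C * infDist x {y | ¬ 0 < r t y})
    (hmass : ∀ t ∈ Icc 0 T, ∀ x, 0 < r t x →
      deriv (fun τ => r τ x) t + @inner ℝ _ _ (v t x) (gradient (r t) x) +
        κ * r t x * vdiv (v t) x = 0)
    (hmom : ∀ t ∈ Icc 0 T, ∀ x, 0 < r t x →
      deriv (fun τ => v τ x) t + fderiv ℝ (v t) x (v t x) + gradient (r t) x = 0) :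
    ∃ R, 0 ≤ R ∧ ∀ t ∈ Icc 0 T, ∀ x, 0 < r t x → ‖x‖ ≤ R := by
  have h0T : (0 : ℝ) ∈ Icc 0 T := ⟨le_rfl, hT.le⟩
  have hC : 0 < C := hc.trans_le hcC
  have hfar : ∀ t ∈ Icc 0 T, ∃ R M, 0 ≤ R ∧ 0 ≤ M ∧
      ∀ x, 0 < r t x → ‖x‖ ≤ R ∧ ‖v t x‖ ≤ M := fun t ht => by
    obtain ⟨R, hR⟩ := (hbdd t ht).exists_norm_le
    obtain ⟨M, hM⟩ := (isCompact_closedBall (0 : EuclideanSpace ℝ (Fin d)) R)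
      |>.exists_bound_of_continuousOn (contDiff_slice hv t).continuous.continuousOn
    refine ⟨max R 0, max M 0, le_max_right _ _, le_max_right _ _, fun x hx => ?_⟩
    exact ⟨(hR x hx).trans (le_max_left _ _),
      (hM x (by simpa using hR x hx)).trans (le_max_left _ _)⟩
  obtain ⟨R₀, M₀, hR₀, hM₀, h₀⟩ := hfar 0 h0T
  refine ⟨R₀ + (M₀ + (C + 1) * T) * T, by positivity, fun t₁ ht₁ x hx => ?_⟩
  obtain ⟨R₁, M₁, hR₁, hM₁, h₁⟩ := hfar t₁ ht₁
  set ρ := R₁ + (M₁ + (C + 1) * T) * T + 1 with hρdef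
  have hρ : 0 < ρ := by positivity
  obtain ⟨B, hB⟩ := ((isCompact_Icc (a := 0) (b := T)).prod
    (isCompact_closedBall (0 : EuclideanSpace ℝ (Fin d)) ρ)).exists_bound_of_continuousOn
    (f := fun p : ℝ × EuclideanSpace ℝ (Fin d) => -2 * κ * vdiv (v p.1) p.2)
    (continuous_const.mul (continuous_vdiv_space hv)).continuousOn
  obtain ⟨ε, hε, hgrad⟩ := exists_norm_fderiv_le_of_lt hr hbdd hc hcC hnd ρ
  obtain ⟨x₁, hxx, hx₁, hxε⟩ := exists_norm_ge_mem_Ioo (contDiff_slice hr t₁).continuous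
    (hbdd t₁ ht₁) hx (ε := ε * Real.exp (-(B * T) / 2)) (by positivity)
  obtain ⟨X, rfl, hXc, hX⟩ := exists_integral_curve_of_contDiff hv hρ ht₁ x₁
  have hsmall : r t₁ (X t₁) ^ 2 * Real.exp (B * T) < ε ^ 2 := by
    have h1 : r t₁ (X t₁) ^ 2 < (ε * Real.exp (-(B * T) / 2)) ^ 2 := by gcongr
    calc r t₁ (X t₁) ^ 2 * Real.exp (B * T)
        < (ε * Real.exp (-(B * T) / 2)) ^ 2 * Real.exp (B * T) := by gcongr
      _ = ε ^ 2 := by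
        rw [mul_pow, ← Real.exp_nat_mul, mul_assoc, ← Real.exp_add]
        simp [mul_div_cancel₀]
  have key : ∀ a ∈ Icc 0 t₁, (∀ t ∈ Icc a t₁, ‖X t‖ ≤ ρ) → 0 < r a (X a) ∧
      ∀ t ∈ Icc a t₁, dist (X a) (X t₁) ≤ (‖v t (X t)‖ + (C + 1) * T) * T := by
    intro a ha hle
    have hsub : Icc a t₁ ⊆ Icc 0 T := Icc_subset_Icc ha.1 ht₁.2
    exact pos_and_dist_le_along_trajectory hr hv hmass hmom ha.2 ha.1 ht₁.2
      (fun t ht => (hX t (hsub ht) (hle t ht)).mono hsub)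
      (fun t ht => hB (t, X t) ⟨hsub ht, by simpa using hle t ht⟩) hx₁ hε hsmall
      (fun t ht => hgrad t (hsub ht) _ (hle t ht))
  have hend : ∀ a ∈ Icc 0 t₁, (∀ t ∈ Icc a t₁, ‖X t‖ ≤ ρ) → ‖X a‖ < ρ := by
    intro a ha hle
    have h2 := (key a ha hle).2 t₁ ⟨ha.2, le_rfl⟩
    have h3 := norm_le_insert' (X a) (X t₁)
    rw [← dist_eq_norm] at h3
    have h4 := h₁ _ hx₁
    have h5 : (‖v t₁ (X t₁)‖ + (C + 1) * T) * T ≤ (M₁ + (C + 1) * T) * T := by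
      gcongr
      exact h4.2
    linarith [h4.1]
  have hstay : ∀ t ∈ Icc 0 t₁, ‖X t‖ ≤ ρ := by
    by_contra! hcon
    obtain ⟨τ, hτ, hτρ⟩ := hcon
    have hXc' : ContinuousOn (fun t => ‖X t‖) (Icc 0 t₁) :=
      (hXc.mono (Icc_subset_Icc le_rfl ht₁.2)).norm
    have hcl : IsCompact (Icc 0 t₁ ∩ (fun t => ‖X t‖) ⁻¹' Ici ρ) :=
      isCompact_Icc.of_isClosed_subset (hXc'.preimage_isClosed_of_isClosed isClosed_Icc
        isClosed_Ici) inter_subset_left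
    obtain ⟨a, ⟨haI, haρ⟩, hamax⟩ := hcl.exists_isGreatest ⟨τ, hτ, hτρ.le⟩
    have hlt : ∀ t ∈ Ioc a t₁, ‖X t‖ < ρ := fun t ht => by
      by_contra! hge
      exact absurd (hamax ⟨⟨haI.1.trans ht.1.le, ht.2⟩, hge⟩) (not_le.2 ht.1)
    have hle : ∀ t ∈ Icc a t₁, ‖X t‖ ≤ ρ := fun t ht => by
      rcases eq_or_lt_of_le ht.1 with rfl | h
      · by_contra! hgt
        obtain ⟨σ, hσ, hσρ⟩ := intermediate_value_Icc' haI.2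
          (hXc'.mono (Icc_subset_Icc haI.1 le_rfl))
          (show ρ ∈ Icc ‖X t₁‖ ‖X a‖ from ⟨by
            have : 0 ≤ (M₁ + (C + 1) * T) * T := by positivity
            linarith [(h₁ _ hx₁).1], hgt.le⟩)
        rcases eq_or_lt_of_le hσ.1 with rfl | h'
        · exact hgt.ne' hσρ
        · exact (hlt σ ⟨h', hσ.2⟩).ne hσρ
      · exact (hlt t ⟨h, ht.2⟩).le
    exact absurd haρ (not_le.2 (hend a haI hle))
  obtain ⟨hpos, hdist⟩ := key 0 ⟨le_rfl, ht₁.1⟩ hstay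
  have h2 := hdist 0 ⟨le_rfl, ht₁.1⟩
  have h3 := norm_le_insert (X 0) (X t₁)
  rw [← dist_eq_norm] at h3
  have h4 := h₀ _ hpos
  have h5 : (‖v 0 (X 0)‖ + (C + 1) * T) * T ≤ (M₀ + (C + 1) * T) * T := by
    gcongr
    exact h4.2
  linarith [h4.1]

end Confinement

section EnergyIdentity

variable {d : ℕ} {κ : ℝ}

/-- The integrand of the time derivative of the energy with weight `φ`, where `g` measures the
failure of `φ` to be a multiple of the power `(1 - κ) / κ`. -/
noncomputable def energyRate (κ : ℝ) (φ g : ℝ → ℝ) (r : EuclideanSpace ℝ (Fin d) → ℝ)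
    (v : EuclideanSpace ℝ (Fin d) → EuclideanSpace ℝ (Fin d)) (s : EuclideanSpace ℝ (Fin d) → ℝ)
    (w : EuclideanSpace ℝ (Fin d) → EuclideanSpace ℝ (Fin d)) (x : EuclideanSpace ℝ (Fin d)) : ℝ :=
  φ (r x) * (-(κ * s x ^ 2 * vdiv v x) -
      2 * κ * r x * @inner ℝ _ _ (w x) (fderiv ℝ v x (w x))) +
    g (r x) * (2 * s x * fderiv ℝ r x (w x) - vdiv v x * (s x ^ 2 + κ * r x * ‖w x‖ ^ 2))

variable {r s : ℝ → EuclideanSpace ℝ (Fin d) → ℝ}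
  {v w : ℝ → EuclideanSpace ℝ (Fin d) → EuclideanSpace ℝ (Fin d)}

theorem contDiff_energyDensity {F : Type*} [NormedAddCommGroup F] [NormedSpace ℝ F] {φ : ℝ → ℝ}
    (hφ : ContDiff ℝ 1 φ) {f g : F → ℝ} {u : F → EuclideanSpace ℝ (Fin d)}
    (hf : ContDiff ℝ 1 f) (hg : ContDiff ℝ 1 g) (hu : ContDiff ℝ 1 u) :
    ContDiff ℝ 1 fun p => φ (f p) * (g p ^ 2 + κ * f p * ‖u p‖ ^ 2) :=
  (hφ.comp hf).mul ((hg.pow 2).add ((contDiff_const.mul hf).mul (hu.norm_sq ℝ)))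

/-- The local energy identity for the linearized equations. -/
theorem deriv_energyDensity_add_vdiv {φ : ℝ → ℝ} (hφ : ContDiff ℝ 1 φ)
    (hφ0 : ∀ y ≤ 0, φ y = 0) (hφ'0 : ∀ y ≤ 0, deriv φ y = 0)
    (hr : ContDiff ℝ 1 (fun p : ℝ × EuclideanSpace ℝ (Fin d) => r p.1 p.2))
    (hv : ContDiff ℝ 1 (fun p : ℝ × EuclideanSpace ℝ (Fin d) => v p.1 p.2))
    (hs : ContDiff ℝ 1 (fun p : ℝ × EuclideanSpace ℝ (Fin d) => s p.1 p.2))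
    (hw : ContDiff ℝ 1 (fun p : ℝ × EuclideanSpace ℝ (Fin d) => w p.1 p.2)) {t : ℝ}
    {x : EuclideanSpace ℝ (Fin d)}
    (hmass : 0 < r t x → deriv (fun τ => r τ x) t + @inner ℝ _ _ (v t x) (gradient (r t) x) +
      κ * r t x * vdiv (v t) x = 0)
    (hlinmass : 0 < r t x → deriv (fun τ => s τ x) t + @inner ℝ _ _ (v t x) (gradient (s t) x) +
      @inner ℝ _ _ (w t x) (gradient (r t) x) +
      κ * (s t x * vdiv (v t) x + r t x * vdiv (w t) x) = 0)
    (hlinmom : 0 < r t x → deriv (fun τ => w τ x) t + fderiv ℝ (w t) x (v t x) +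
      fderiv ℝ (v t) x (w t x) + gradient (s t) x = 0) :
    deriv (fun τ => φ (r τ x) * (s τ x ^ 2 + κ * r τ x * ‖w τ x‖ ^ 2)) t +
      vdiv (fun y => (φ (r t y) * (s t y ^ 2 + κ * r t y * ‖w t y‖ ^ 2)) • v t y) x +
      vdiv (fun y => (2 * κ * (r t y * φ (r t y) * s t y)) • w t y) x =
    energyRate κ φ (fun y => κ * y * deriv φ y - (1 - κ) * φ y) (r t) (v t) (s t) (w t) x := by
  have hr1 := ((contDiff_slice hr t).differentiable one_ne_zero x).hasFDerivAt
  have hs1 := ((contDiff_slice hs t).differentiable one_ne_zero x).hasFDerivAt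
  have hw1 := ((contDiff_slice hw t).differentiable one_ne_zero x).hasFDerivAt
  have hv1 := ((contDiff_slice hv t).differentiable one_ne_zero x)
  have hφ1 := (hφ.differentiable one_ne_zero (r t x)).hasDerivAt
  have hφr := hφ1.comp_hasFDerivAt x hr1
  have hF := hφr.mul ((hs1.pow 2).add ((hr1.const_mul κ).mul hw1.norm_sq))
  have hG := ((hr1.mul hφr).mul hs1).const_mul (2 * κ)
  have hFt := (hφ1.comp t (hasDerivAt_time hr t x)).mul (((hasDerivAt_time hs t x).pow 2).add
    (((hasDerivAt_time hr t x).const_mul κ).mul (hasDerivAt_time hw t x).norm_sq))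
  rw [vdiv_smul (f := fun y => φ (r t y) * (s t y ^ 2 + κ * r t y * ‖w t y‖ ^ 2))
      hF.differentiableAt hv1,
    vdiv_smul (f := fun y => 2 * κ * (r t y * φ (r t y) * s t y)) hG.differentiableAt
      hw1.differentiableAt]
  erw [hFt.deriv, hF.fderiv, hG.fderiv]
  simp only [energyRate]
  rcases le_or_gt (r t x) 0 with h | h
  · simp [hφ0 _ h, hφ'0 _ h]
  have e1 := hmass h
  have e2 := hlinmass h
  have e3 := congrArg (fun z => @inner ℝ _ _ (w t x) z) (hlinmom h)
  simp only [inner_gradient_right, starRingEnd_apply, star_trivial, inner_add_right,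
    inner_zero_right] at e1 e2 e3
  simp
  linear_combination (deriv φ (r t x) * (s t x ^ 2 + κ * r t x * ‖w t x‖ ^ 2) +
    κ * φ (r t x) * ‖w t x‖ ^ 2) * e1 + 2 * φ (r t x) * s t x * e2 +
    2 * κ * φ (r t x) * r t x * e3

theorem continuous_fderiv_apply_space {E F : Type*} [NormedAddCommGroup E] [NormedSpace ℝ E]
    [NormedAddCommGroup F] [NormedSpace ℝ F] {f : ℝ → E → F} {u : ℝ × E → E}
    (hf : ContDiff ℝ 1 (fun p : ℝ × E => f p.1 p.2)) (hu : Continuous u) :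
    Continuous fun p : ℝ × E => fderiv ℝ (f p.1) p.2 (u p) :=
  (continuous_fderiv_space hf).clm_apply hu

/-- The derivative of a regularized energy as an integral over the moving domain. -/
theorem setIntegral_deriv_energyDensity {φ : ℝ → ℝ} (hφ : ContDiff ℝ 1 φ)
    (hφ0 : ∀ y ≤ 0, φ y = 0) (hφ'0 : ∀ y ≤ 0, deriv φ y = 0)
    (hr : ContDiff ℝ 1 (fun p : ℝ × EuclideanSpace ℝ (Fin d) => r p.1 p.2))
    (hv : ContDiff ℝ 1 (fun p : ℝ × EuclideanSpace ℝ (Fin d) => v p.1 p.2))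
    (hs : ContDiff ℝ 1 (fun p : ℝ × EuclideanSpace ℝ (Fin d) => s p.1 p.2))
    (hw : ContDiff ℝ 1 (fun p : ℝ × EuclideanSpace ℝ (Fin d) => w p.1 p.2)) {t R : ℝ}
    (hR : ∀ x, 0 < r t x → ‖x‖ ≤ R)
    (hmass : ∀ x, 0 < r t x → deriv (fun τ => r τ x) t +
      @inner ℝ _ _ (v t x) (gradient (r t) x) + κ * r t x * vdiv (v t) x = 0)
    (hlinmass : ∀ x, 0 < r t x → deriv (fun τ => s τ x) t +
      @inner ℝ _ _ (v t x) (gradient (s t) x) + @inner ℝ _ _ (w t x) (gradient (r t) x) +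
      κ * (s t x * vdiv (v t) x + r t x * vdiv (w t) x) = 0)
    (hlinmom : ∀ x, 0 < r t x → deriv (fun τ => w τ x) t + fderiv ℝ (w t) x (v t x) +
      fderiv ℝ (v t) x (w t x) + gradient (s t) x = 0) :
    ∫ x in closedBall 0 R, deriv (fun τ => φ (r τ x) *
        (s τ x ^ 2 + κ * r τ x * ‖w τ x‖ ^ 2)) t =
      ∫ x in {x | 0 < r t x},
        energyRate κ φ (fun y => κ * y * deriv φ y - (1 - κ) * φ y) (r t) (v t) (s t) (w t) x := by
  have hr0 : ∀ x ∉ closedBall (0 : EuclideanSpace ℝ (Fin d)) R, r t x ≤ 0 := fun x hx => by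
    by_contra! h
    exact hx (by simpa using hR x h)
  have hid := fun x => deriv_energyDensity_add_vdiv hφ hφ0 hφ'0 hr hv hs hw (hmass x)
    (hlinmass x) (hlinmom x)
  have hrt := contDiff_slice hr t
  have hst := contDiff_slice hs t
  have hwt := contDiff_slice hw t
  obtain ⟨hi1, h1⟩ := integral_vdiv_eq_zero
    (u := fun y => (φ (r t y) * (s t y ^ 2 + κ * r t y * ‖w t y‖ ^ 2)) • v t y)
    ((contDiff_energyDensity hφ hrt hst hwt).smul (contDiff_slice hv t))
    (HasCompactSupport.intro (isCompact_closedBall 0 R) fun x hx => by simp [hφ0 _ (hr0 x hx)])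
  obtain ⟨hi2, h2⟩ := integral_vdiv_eq_zero
    (u := fun y => (2 * κ * (r t y * φ (r t y) * s t y)) • w t y)
    ((contDiff_const.mul ((hrt.mul (hφ.comp hrt)).mul hst)).smul hwt)
    (HasCompactSupport.intro (isCompact_closedBall 0 R) fun x hx => by simp [hφ0 _ (hr0 x hx)])
  set f := fun x => deriv (fun τ => φ (r τ x) * (s τ x ^ 2 + κ * r τ x * ‖w τ x‖ ^ 2)) t
    with hf
  have hfc : Continuous f :=
    (continuous_deriv_time (f := fun τ x => φ (r τ x) * (s τ x ^ 2 + κ * r τ x * ‖w τ x‖ ^ 2))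
      (contDiff_energyDensity hφ hr hs hw)).comp
      (by fun_prop : Continuous fun x : EuclideanSpace ℝ (Fin d) => (t, x))
  have hf0 : ∀ x, r t x ≤ 0 → f x = 0 := fun x hx => by
    have hd := ((hφ.differentiable one_ne_zero (r t x)).hasDerivAt.comp t
      (hasDerivAt_time hr t x)).mul (((hasDerivAt_time hs t x).pow 2).add
      (((hasDerivAt_time hr t x).const_mul κ).mul (hasDerivAt_time hw t x).norm_sq))
    refine hd.deriv.trans ?_
    simp [hφ0 _ hx, hφ'0 _ hx]
  have hfi : Integrable f := hfc.integrable_of_hasCompactSupport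
    (HasCompactSupport.intro (isCompact_closedBall 0 R) fun x hx => hf0 x (hr0 x hx))
  rw [setIntegral_eq_integral_of_forall_compl_eq_zero fun x hx => hf0 x (hr0 x hx)]
  rw [setIntegral_eq_integral_of_forall_compl_eq_zero fun x hx => ?_]
  · simp_rw [← hid]
    refine Eq.symm ((integral_add (hfi.add hi1) hi2).trans ?_)
    rw [h2, add_zero, integral_add' hfi hi1, h1, add_zero]
  · have hx' : r t x ≤ 0 := not_lt.1 hx
    simp [energyRate, hφ0 _ hx', hφ'0 _ hx']

end EnergyIdentity

section Regularization

theorem exists_abs_cutPow_defect_le {κ : ℝ} (hκ : 0 < κ) :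
    ∃ N, 0 ≤ N ∧ ∀ ε > 0, ∀ x > 0,
      |κ * x * deriv (cutPow ((1 - κ) / κ) ε) x - (1 - κ) * cutPow ((1 - κ) / κ) ε x| ≤
        if x < ε then N * x ^ ((1 - κ) / κ) else 0 := by
  obtain ⟨M, hM, h⟩ := exists_abs_deriv_smoothTransition_le
  refine ⟨2 * κ * M, by positivity, fun ε hε x hx => ?_⟩
  have heq : κ * x * deriv (cutPow ((1 - κ) / κ) ε) x - (1 - κ) * cutPow ((1 - κ) / κ) ε x =
      κ * (2 * (x / ε)) * deriv Real.smoothTransition (2 * x / ε - 1) * x ^ ((1 - κ) / κ) := by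
    rw [mul_assoc κ, mul_deriv_cutPow_of_pos hx]
    field_simp
    ring
  rw [heq]
  split_ifs with hlt
  · have h1 : x / ε ≤ 1 := (div_le_one hε).2 hlt.le
    have h2 : 0 < x / ε := by positivity
    have h3 : 0 < x ^ ((1 - κ) / κ) := Real.rpow_pos_of_pos hx _
    rw [abs_mul, abs_mul, abs_of_pos h3, abs_of_pos (show 0 < κ * (2 * (x / ε)) by positivity)]
    calc κ * (2 * (x / ε)) * |deriv Real.smoothTransition (2 * x / ε - 1)| * x ^ ((1 - κ) / κ)
        ≤ κ * (2 * 1) * M * x ^ ((1 - κ) / κ) := by gcongr; exact h _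
      _ = _ := by ring
  · have : 1 ≤ x / ε := (one_le_div hε).2 (not_lt.1 hlt)
    rw [deriv_smoothTransition_eq_zero_of_one_le (by rw [mul_div_assoc]; linarith)]
    simp

theorem abs_cutPow_sub_rpow_le {β ε x : ℝ} (hε : 0 < ε) (hx : 0 < x) :
    |cutPow β ε x - x ^ β| ≤ if x < ε then x ^ β else 0 := by
  split_ifs with h
  · rw [abs_le]
    constructor <;> linarith [cutPow_nonneg (β := β) (x := x) hε,
      cutPow_le_rpow (β := β) (ε := ε) hx, Real.rpow_nonneg hx.le β]
  · simp [cutPow_eq_rpow hε (not_lt.1 h)]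

variable {E : Type*} [NormedAddCommGroup E] [MeasurableSpace E] [BorelSpace E] {μ : Measure E}

theorem integrableOn_rpow_of_setLIntegral_ne_top {f : E → ℝ} (hf : Continuous f) {β : ℝ}
    (h : ∫⁻ x in {x | 0 < f x}, ENNReal.ofReal (f x ^ β) ∂μ ≠ ⊤) :
    IntegrableOn (fun x => f x ^ β) {x | 0 < f x} μ := by
  have hΩ : MeasurableSet {x | 0 < f x} := (isOpen_lt continuous_const hf).measurableSet
  refine (lintegral_ofReal_ne_top_iff_integrable ?_ ?_).1 h
  · exact (hf.measurable.pow_const β).aestronglyMeasurable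
  · exact (ae_restrict_iff' hΩ).2 (.of_forall fun x hx => Real.rpow_nonneg (le_of_lt hx) _)

theorem rpow_eq_rpow_mul_rpow_sub_one {b x : ℝ} (hx : 0 < x) :
    x ^ (b + (b - 1)) = x ^ b * x ^ (b - 1) :=
  Real.rpow_add hx _ _

theorem integrableOn_rpow_mul [NormedSpace ℝ E] [FiniteDimensional ℝ E] {f g : E → ℝ}
    (hf : Continuous f)
    (hg : Continuous g) {R b : ℝ} (hR : ∀ x, 0 < f x → ‖x‖ ≤ R) (hb : 0 < b)
    (h : IntegrableOn (fun x => f x ^ (b - 1)) {x | 0 < f x} μ) :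
    IntegrableOn (fun x => f x ^ (b + (b - 1)) * g x) {x | 0 < f x} μ := by
  have hΩ : MeasurableSet {x | 0 < f x} := (isOpen_lt continuous_const hf).measurableSet
  have hc : Continuous fun x => f x ^ b * g x :=
    ((Real.continuous_rpow_const hb.le).comp hf).mul hg
  obtain ⟨M, hM⟩ := (isCompact_closedBall (0 : E) R).exists_bound_of_continuousOn hc.continuousOn
  refine (Integrable.bdd_mul (c := M) h hc.aestronglyMeasurable
    ((ae_restrict_iff' hΩ).2 (.of_forall fun x hx => hM x (by simpa using hR x hx)))).congr
    ((ae_restrict_iff' hΩ).2 (.of_forall fun x hx => ?_))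
  simp only [rpow_eq_rpow_mul_rpow_sub_one (show 0 < f x from hx)]
  ring

/-- Two functions differing only in a boundary layer, by a multiple of a power of the defining
function, have close integrals. -/
theorem abs_setIntegral_sub_le {f g₁ g₂ : E → ℝ} (hf : Continuous f) {b ε P : ℝ} (hb : 0 < b)
    (hP : 0 ≤ P) (hε : 0 < ε)
    (h : IntegrableOn (fun x => f x ^ (b - 1)) {x | 0 < f x} μ)
    (h₁ : IntegrableOn g₁ {x | 0 < f x} μ) (h₂ : IntegrableOn g₂ {x | 0 < f x} μ)
    (hle : ∀ x, 0 < f x → |g₁ x - g₂ x| ≤ P * if f x < ε then f x ^ (b + (b - 1)) else 0) :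
    |∫ x in {x | 0 < f x}, g₁ x ∂μ - ∫ x in {x | 0 < f x}, g₂ x ∂μ| ≤
      P * ε ^ b * ∫ x in {x | 0 < f x}, f x ^ (b - 1) ∂μ := by
  have hΩ : MeasurableSet {x | 0 < f x} := (isOpen_lt continuous_const hf).measurableSet
  rw [← integral_sub h₁ h₂, ← integral_const_mul]
  rw [← Real.norm_eq_abs]
  refine norm_integral_le_of_norm_le (h.const_mul _)
    ((ae_restrict_iff' hΩ).2 (.of_forall fun x (hx : 0 < f x) => ?_))
  refine (hle x hx).trans ?_
  rw [mul_assoc]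
  gcongr
  split_ifs with hlt
  · rw [rpow_eq_rpow_mul_rpow_sub_one hx]
    gcongr
  · have := Real.rpow_nonneg hx.le (b - 1)
    positivity

end Regularization

theorem abs_energyRate_rpow_le {d : ℕ} {κ Mv β : ℝ} (hκ : 0 < κ)
    {r s : EuclideanSpace ℝ (Fin d) → ℝ}
    {v w : EuclideanSpace ℝ (Fin d) → EuclideanSpace ℝ (Fin d)} {x : EuclideanSpace ℝ (Fin d)}
    (hx : 0 < r x) (hv : ‖fderiv ℝ v x‖ ≤ Mv) :
    |energyRate κ (· ^ β) (fun _ => 0) r v s w x| ≤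
      (κ * d + 2) * Mv * (r x ^ β * (s x ^ 2 + κ * r x * ‖w x‖ ^ 2)) := by
  have hMv : 0 ≤ Mv := (norm_nonneg _).trans hv
  have h1 : |vdiv v x| ≤ d * Mv := (abs_vdiv_le v x).trans (by gcongr)
  have h2 : |@inner ℝ _ _ (w x) (fderiv ℝ v x (w x))| ≤ Mv * ‖w x‖ ^ 2 := by
    refine (abs_real_inner_le_norm _ _).trans ?_
    have := (fderiv ℝ v x).le_of_opNorm_le hv (w x)
    calc ‖w x‖ * ‖fderiv ℝ v x (w x)‖ ≤ ‖w x‖ * (Mv * ‖w x‖) := by gcongr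
      _ = _ := by ring
  have h3 : 0 ≤ r x ^ β := Real.rpow_nonneg hx.le β
  simp only [energyRate, zero_mul, add_zero]
  rw [abs_mul, abs_of_nonneg h3, mul_left_comm]
  gcongr
  have h4 : |-(κ * s x ^ 2 * vdiv v x)| ≤ κ * s x ^ 2 * (d * Mv) := by
    rw [abs_neg, abs_mul, abs_of_nonneg (show 0 ≤ κ * s x ^ 2 by positivity)]
    gcongr
  have h5 : |2 * κ * r x * @inner ℝ _ _ (w x) (fderiv ℝ v x (w x))| ≤
      2 * κ * r x * (Mv * ‖w x‖ ^ 2) := by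
    rw [abs_mul, abs_of_nonneg (show 0 ≤ 2 * κ * r x by positivity)]
    gcongr
  refine (abs_sub _ _).trans ((add_le_add h4 h5).trans ?_)
  have h6 : 0 ≤ Mv * s x ^ 2 := by positivity
  have h7 : 0 ≤ κ * d * (Mv * (κ * r x * ‖w x‖ ^ 2)) := by positivity
  linarith

section EnergyDerivative

variable {d : ℕ} {κ T R c C : ℝ} {r s : ℝ → EuclideanSpace ℝ (Fin d) → ℝ}
  {v w : ℝ → EuclideanSpace ℝ (Fin d) → EuclideanSpace ℝ (Fin d)}

theorem exists_integrableOn_rpow_and_setIntegral_le [NeZero d]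
    (hr : ContDiff ℝ 1 (fun p : ℝ × EuclideanSpace ℝ (Fin d) => r p.1 p.2))
    (hR : ∀ t ∈ Icc 0 T, ∀ x, 0 < r t x → ‖x‖ ≤ R) (hc : 0 < c) (hcC : c ≤ C)
    (hnd : ∀ t ∈ Icc 0 T, ∀ x, 0 < r t x →
      c * infDist x {y | ¬ 0 < r t y} ≤ r t x ∧ r t x ≤ C * infDist x {y | ¬ 0 < r t y})
    {b : ℝ} (hb : 0 < b) :
    ∃ A, 0 ≤ A ∧ ∀ t ∈ Icc 0 T, IntegrableOn (fun x => r t x ^ (b - 1)) {x | 0 < r t x} ∧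
      ∫ x in {x | 0 < r t x}, r t x ^ (b - 1) ≤ A := by
  obtain ⟨ρ, hρ, hρ1, hmod⟩ := exists_uniform_modulus_fderiv hr T (R + 1)
    (show 0 < c / 4 by positivity)
  obtain ⟨m, hm⟩ := ((isCompact_Icc (a := 0) (b := T)).prod
    (isCompact_closedBall (0 : EuclideanSpace ℝ (Fin d)) R)).exists_bound_of_continuousOn
    hr.continuous.continuousOn
  obtain ⟨A, hA, h⟩ := exists_setLIntegral_rpow_le (E := EuclideanSpace ℝ (Fin d))
    (μ := volume) (R := R) hc hρ hρ1 (le_max_right m 0) hb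
  refine ⟨A.toReal, ENNReal.toReal_nonneg, fun t ht => ?_⟩
  have hrt := contDiff_slice hr t
  have hball : ∀ x, 0 < r t x → x ∈ closedBall (0 : EuclideanSpace ℝ (Fin d)) R := fun x hx => by
    simpa using hR t ht x hx
  have hle := h (r t) hrt hball
    (fun x hx => (le_abs_self _).trans ((hm (t, x) ⟨ht, hball x hx⟩).trans (le_max_left _ _)))
    (fun x hx => by
      obtain ⟨y, hy, hy'⟩ := exists_boundary_norm_fderiv_mem_Icc
        (hrt.differentiable one_ne_zero) hc hcC (hnd t ht)
        (nonempty_not_pos_of_isBounded (isBounded_closedBall.subset hball)) hx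
      exact ⟨y, hy, hy'.1⟩)
    (hmod t ht)
  have hi := integrableOn_rpow_of_setLIntegral_ne_top hrt.continuous (ne_top_of_le_ne_top hA hle)
  refine ⟨hi, ?_⟩
  have hΩ : MeasurableSet {x | 0 < r t x} :=
    (isOpen_lt continuous_const hrt.continuous).measurableSet
  rw [integral_eq_lintegral_of_nonneg_ae ((ae_restrict_iff' hΩ).2
    (.of_forall fun x hx => Real.rpow_nonneg (le_of_lt hx) _)) hi.aestronglyMeasurable]
  exact ENNReal.toReal_mono hA hle

/-- The derivative of the weighted energy of a solution of the linearized equations. -/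
theorem hasDerivWithinAt_linEnergy [NeZero d] (hκ : 0 < κ)
    (hr : ContDiff ℝ 1 (fun p : ℝ × EuclideanSpace ℝ (Fin d) => r p.1 p.2))
    (hv : ContDiff ℝ 1 (fun p : ℝ × EuclideanSpace ℝ (Fin d) => v p.1 p.2))
    (hs : ContDiff ℝ 1 (fun p : ℝ × EuclideanSpace ℝ (Fin d) => s p.1 p.2))
    (hw : ContDiff ℝ 1 (fun p : ℝ × EuclideanSpace ℝ (Fin d) => w p.1 p.2))
    (hR : ∀ t ∈ Icc 0 T, ∀ x, 0 < r t x → ‖x‖ ≤ R) (hc : 0 < c) (hcC : c ≤ C)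
    (hnd : ∀ t ∈ Icc 0 T, ∀ x, 0 < r t x →
      c * infDist x {y | ¬ 0 < r t y} ≤ r t x ∧ r t x ≤ C * infDist x {y | ¬ 0 < r t y})
    (hmass : ∀ t ∈ Icc 0 T, ∀ x, 0 < r t x → deriv (fun τ => r τ x) t +
      @inner ℝ _ _ (v t x) (gradient (r t) x) + κ * r t x * vdiv (v t) x = 0)
    (hlinmass : ∀ t ∈ Icc 0 T, ∀ x, 0 < r t x → deriv (fun τ => s τ x) t +
      @inner ℝ _ _ (v t x) (gradient (s t) x) + @inner ℝ _ _ (w t x) (gradient (r t) x) +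
      κ * (s t x * vdiv (v t) x + r t x * vdiv (w t) x) = 0)
    (hlinmom : ∀ t ∈ Icc 0 T, ∀ x, 0 < r t x → deriv (fun τ => w τ x) t +
      fderiv ℝ (w t) x (v t x) + fderiv ℝ (v t) x (w t x) + gradient (s t) x = 0)
    {t : ℝ} (ht : t ∈ Icc 0 T) :
    IntegrableOn (fun x => r t x ^ ((1 - κ) / κ) * (s t x ^ 2 + κ * r t x * ‖w t x‖ ^ 2))
      {x | 0 < r t x} ∧
    HasDerivWithinAt (fun τ => linEnergy κ (r τ) (s τ) (w τ))
      (∫ x in {x | 0 < r t x},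
        energyRate κ (· ^ ((1 - κ) / κ)) (fun _ => 0) (r t) (v t) (s t) (w t) x) (Icc 0 T) t := by
  set α := (1 - κ) / κ with hα
  obtain ⟨b, hb, hαb⟩ : ∃ b, 0 < b ∧ α = b + (b - 1) :=
    ⟨1 / (2 * κ), by positivity, by rw [hα]; field_simp; ring⟩
  obtain ⟨A, hA, hinteg⟩ := exists_integrableOn_rpow_and_setIntegral_le hr hR hc hcC hnd hb
  obtain ⟨N, hN, hdef⟩ := exists_abs_cutPow_defect_le hκ
  rw [← hα] at hdef
  set Q : ℝ → EuclideanSpace ℝ (Fin d) → ℝ := fun t x =>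
    s t x ^ 2 + κ * r t x * ‖w t x‖ ^ 2 with hQ
  set P₁ : ℝ → EuclideanSpace ℝ (Fin d) → ℝ := fun t x => -(κ * s t x ^ 2 * vdiv (v t) x) -
    2 * κ * r t x * @inner ℝ _ _ (w t x) (fderiv ℝ (v t) x (w t x)) with hP₁
  set P₂ : ℝ → EuclideanSpace ℝ (Fin d) → ℝ := fun t x =>
    2 * s t x * fderiv ℝ (r t) x (w t x) - vdiv (v t) x * Q t x with hP₂
  have hdiv := continuous_vdiv_space hv
  have hr0 := hr.continuous
  have hs0 := hs.continuous
  have hw0 := hw.continuous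
  have hDv := continuous_fderiv_apply_space hv hw0
  have hDr := continuous_fderiv_apply_space hr hw0
  have hQc : Continuous fun p : ℝ × EuclideanSpace ℝ (Fin d) => Q p.1 p.2 := by
    simp only [hQ]; fun_prop
  have hP₁c : Continuous fun p : ℝ × EuclideanSpace ℝ (Fin d) => P₁ p.1 p.2 := by
    simp only [hP₁]; fun_prop
  have hP₂c : Continuous fun p : ℝ × EuclideanSpace ℝ (Fin d) => P₂ p.1 p.2 := by
    simp only [hP₂]; fun_prop
  have hslice : ∀ {f : ℝ → EuclideanSpace ℝ (Fin d) → ℝ},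
      Continuous (fun p : ℝ × EuclideanSpace ℝ (Fin d) => f p.1 p.2) → ∀ t, Continuous (f t) :=
    fun hf t => hf.comp (by fun_prop : Continuous fun x : EuclideanSpace ℝ (Fin d) => (t, x))
  have hbound : ∀ {f : ℝ → EuclideanSpace ℝ (Fin d) → ℝ},
      Continuous (fun p : ℝ × EuclideanSpace ℝ (Fin d) => f p.1 p.2) →
      ∃ P, 0 ≤ P ∧ ∀ t ∈ Icc 0 T, ∀ x, 0 < r t x → |f t x| ≤ P := fun hf => by
    obtain ⟨P, hP⟩ := ((isCompact_Icc (a := 0) (b := T)).prod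
      (isCompact_closedBall (0 : EuclideanSpace ℝ (Fin d)) R)).exists_bound_of_continuousOn
      hf.continuousOn
    exact ⟨max P 0, le_max_right _ _, fun t ht x hx =>
      (hP (t, x) ⟨ht, by simpa using hR t ht x hx⟩).trans (le_max_left _ _)⟩
  obtain ⟨M₀, hM₀, hQle⟩ := hbound hQc
  obtain ⟨M₁, hM₁, hP₁le⟩ := hbound hP₁c
  obtain ⟨M₂, hM₂, hP₂le⟩ := hbound hP₂c
  have hipow : ∀ {f : ℝ → EuclideanSpace ℝ (Fin d) → ℝ},
      Continuous (fun p : ℝ × EuclideanSpace ℝ (Fin d) => f p.1 p.2) → ∀ t ∈ Icc 0 T,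
      IntegrableOn (fun x => r t x ^ α * f t x) {x | 0 < r t x} := fun hf t ht => by
    rw [hαb]
    exact integrableOn_rpow_mul (hslice hr0 t) (hslice hf t) (hR t ht) hb (hinteg t ht).1
  have hicont : ∀ t ∈ Icc 0 T, ∀ {f : EuclideanSpace ℝ (Fin d) → ℝ}, Continuous f →
      IntegrableOn f {x | 0 < r t x} := fun t ht f hf =>
    (hf.continuousOn.integrableOn_compact (isCompact_closedBall 0 R)).mono_set
      fun x hx => by simpa using hR t ht x hx
  refine ⟨hipow hQc t ht, ?_⟩
  set Rate : ℝ → ℝ := fun t => ∫ x in {x | 0 < r t x},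
    energyRate κ (· ^ α) (fun _ => 0) (r t) (v t) (s t) (w t) x with hRate
  refine hasDerivWithinAt_Icc_of_uniform_approx (D := Rate) (fun ω hω => ?_) ht
  set P := M₀ + M₁ + N * M₂ with hP
  have hP0 : 0 ≤ P := by positivity
  obtain ⟨ε, hε, hεω⟩ : ∃ ε > 0, P * ε ^ b * A ≤ ω := by
    refine ⟨(ω / (P * A + 1)) ^ b⁻¹, by positivity, ?_⟩
    rw [Real.rpow_inv_rpow (by positivity) hb.ne', mul_right_comm, mul_div_assoc',
      div_le_iff₀ (by positivity)]
    nlinarith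
  have hφ := contDiff_cutPow (β := α) hε
  have hφ0 : ∀ y ≤ 0, cutPow α ε y = 0 := fun y hy => cutPow_eq_zero hε (by linarith)
  have hφ'0 : ∀ y ≤ 0, deriv (cutPow α ε) y = 0 := fun y hy => deriv_cutPow_of_nonpos hε hy
  let F : ℝ → EuclideanSpace ℝ (Fin d) → ℝ := fun τ x =>
    cutPow α ε (r τ x) * (s τ x ^ 2 + κ * r τ x * ‖w τ x‖ ^ 2)
  have hF : ContDiff ℝ 1 fun p : ℝ × EuclideanSpace ℝ (Fin d) => F p.1 p.2 :=
    contDiff_energyDensity hφ hr hs hw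
  refine ⟨fun t => ∫ x in closedBall 0 R, F t x,
    fun t => ∫ x in closedBall 0 R, deriv (fun τ => F τ x) t,
    fun t _ => hasDerivAt_setIntegral_of_contDiff hF (isCompact_closedBall 0 R) t,
    continuous_parametric_integral_of_continuous (continuous_deriv_time hF)
      (isCompact_closedBall 0 R), fun t ht => ?_⟩
  have herr : ∀ {g₁ g₂ : EuclideanSpace ℝ (Fin d) → ℝ}, IntegrableOn g₁ {x | 0 < r t x} →
      IntegrableOn g₂ {x | 0 < r t x} →
      (∀ x, 0 < r t x → |g₁ x - g₂ x| ≤ P * if r t x < ε then r t x ^ α else 0) →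
      |(∫ x in {x | 0 < r t x}, g₁ x) - ∫ x in {x | 0 < r t x}, g₂ x| ≤ ω := fun h₁ h₂ hle => by
    rw [hαb] at hle
    refine (abs_setIntegral_sub_le (hslice hr0 t) hb hP0 hε (hinteg t ht).1 h₁ h₂ hle).trans ?_
    refine le_trans ?_ hεω
    gcongr
    exact (hinteg t ht).2
  have hite : ∀ x, 0 < r t x → 0 ≤ if r t x < ε then r t x ^ α else 0 := fun x hx => by
    have := Real.rpow_nonneg hx.le α
    split_ifs <;> simp [this]
  have hφc := (hφ.continuous.comp (hslice hr0 t))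
  have hφ'c := ((hφ.continuous_deriv le_rfl).comp (hslice hr0 t))
  beta_reduce
  constructor
  · have hsub : {x | 0 < r t x} ⊆ closedBall (0 : EuclideanSpace ℝ (Fin d)) R := fun x hx => by
      simpa using hR t ht x hx
    rw [setIntegral_eq_of_subset_of_forall_sdiff_eq_zero measurableSet_closedBall hsub
      fun x hx => by simp [F, hφ0 _ (not_lt.1 hx.2)]]
    refine herr (hicont t ht (hφc.mul (hslice hQc t))) (hipow hQc t ht) fun x hx => ?_
    rw [← sub_mul, abs_mul, mul_comm]
    have h1 := abs_cutPow_sub_rpow_le (β := α) hε hx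
    have h2 : |Q t x| ≤ P := (hQle t ht x hx).trans (by
      rw [hP, add_assoc]; exact le_add_of_nonneg_right (by positivity))
    gcongr
  · rw [setIntegral_deriv_energyDensity hφ hφ0 hφ'0 hr hv hs hw (hR t ht) (hmass t ht)
      (hlinmass t ht) (hlinmom t ht)]
    refine herr (hicont t ht ?_) ?_ fun x hx => ?_
    · exact (hφc.mul (hslice hP₁c t)).add (((((continuous_const.mul (hslice hr0 t)).mul hφ'c).sub
        (continuous_const.mul hφc))).mul (hslice hP₂c t))
    · convert hipow hP₁c t ht using 2 with x
      simp only [energyRate, hP₁, zero_mul, add_zero]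
    · have h1 := abs_cutPow_sub_rpow_le (β := α) hε hx
      have h2 := hdef ε hε _ hx
      rw [← mul_ite_zero] at h2
      have h3 := hP₁le t ht x hx
      have h4 := hP₂le t ht x hx
      have h5 := hite x hx
      calc _ = |(cutPow α ε (r t x) - r t x ^ α) * P₁ t x +
            (κ * r t x * deriv (cutPow α ε) (r t x) - (1 - κ) * cutPow α ε (r t x)) * P₂ t x| := by
            congr 1
            simp only [energyRate, hP₁, hP₂, hQ]
            ring
        _ ≤ |cutPow α ε (r t x) - r t x ^ α| * |P₁ t x| +
            |κ * r t x * deriv (cutPow α ε) (r t x) - (1 - κ) * cutPow α ε (r t x)| *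
              |P₂ t x| := by
            rw [← abs_mul, ← abs_mul]
            exact abs_add_le _ _
        _ ≤ (if r t x < ε then r t x ^ α else 0) * M₁ +
            (N * if r t x < ε then r t x ^ α else 0) * M₂ := by gcongr
        _ ≤ _ := by
            rw [hP]
            nlinarith [mul_nonneg hM₀ h5]

end EnergyDerivative

/-- **Energy estimate for the linearized equation** (Proposition 3.1 of Ifrim–Tataru):
if `(r,v)` solves the free-boundary compressible Euler system with bounded,
nondegenerate moving domains, and `(s,w)` solves the linearized system on the moving
domain, then `t ↦ ‖(s,w)(t)‖²_H` is differentiable and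
`|d/dt ‖(s,w)(t)‖²_H| ≤ K ‖∇v(t)‖_{L^∞(Ω_t)} ‖(s,w)(t)‖²_H`, with `K = K(d,κ)`. -/
theorem linearized_energy_estimate
    {d : ℕ} (hd : 1 ≤ d) {κ : ℝ} (hκ : 0 < κ) :
    ∃ K > (0:ℝ),
      ∀ T > (0:ℝ),
      ∀ (r : ℝ → EuclideanSpace ℝ (Fin d) → ℝ)
        (v : ℝ → EuclideanSpace ℝ (Fin d) → EuclideanSpace ℝ (Fin d))
        (s : ℝ → EuclideanSpace ℝ (Fin d) → ℝ)
        (w : ℝ → EuclideanSpace ℝ (Fin d) → EuclideanSpace ℝ (Fin d)),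
      -- regularity: all fields are continuously differentiable in `(t,x)`
      ContDiff ℝ 1 (fun p : ℝ × EuclideanSpace ℝ (Fin d) => r p.1 p.2) →
      ContDiff ℝ 1 (fun p : ℝ × EuclideanSpace ℝ (Fin d) => v p.1 p.2) →
      ContDiff ℝ 1 (fun p : ℝ × EuclideanSpace ℝ (Fin d) => s p.1 p.2) →
      ContDiff ℝ 1 (fun p : ℝ × EuclideanSpace ℝ (Fin d) => w p.1 p.2) →
      -- bounded moving domains
      (∀ t ∈ Icc (0:ℝ) T, Bornology.IsBounded {x | 0 < r t x}) →
      -- nondegenerate defining functions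
      (∃ c C : ℝ, 0 < c ∧ c ≤ C ∧
        ∀ t ∈ Icc (0:ℝ) T, ∀ x, 0 < r t x →
          c * infDist x {y | ¬ 0 < r t y} ≤ r t x ∧
          r t x ≤ C * infDist x {y | ¬ 0 < r t y}) →
      -- the compressible Euler equations on the moving domain
      (∀ t ∈ Icc (0:ℝ) T, ∀ x, 0 < r t x →
          deriv (fun τ => r τ x) t + @inner ℝ _ _ (v t x) (gradient (r t) x) +
            κ * r t x * vdiv (v t) x = 0) →
      (∀ t ∈ Icc (0:ℝ) T, ∀ x, 0 < r t x →
          deriv (fun τ => v τ x) t + fderiv ℝ (v t) x (v t x) + gradient (r t) x = 0) →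
      -- the linearized equations on the moving domain
      (∀ t ∈ Icc (0:ℝ) T, ∀ x, 0 < r t x →
          deriv (fun τ => s τ x) t + @inner ℝ _ _ (v t x) (gradient (s t) x) +
            @inner ℝ _ _ (w t x) (gradient (r t) x) +
            κ * (s t x * vdiv (v t) x + r t x * vdiv (w t) x) = 0) →
      (∀ t ∈ Icc (0:ℝ) T, ∀ x, 0 < r t x →
          deriv (fun τ => w τ x) t + fderiv ℝ (w t) x (v t x) +
            fderiv ℝ (v t) x (w t x) + gradient (s t) x = 0) →
      -- conclusion: differentiability and the energy estimate
      ∀ t ∈ Icc (0:ℝ) T, ∀ Mv : ℝ, 0 ≤ Mv →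
        (∀ x, 0 < r t x → ‖fderiv ℝ (v t) x‖ ≤ Mv) →
        ∃ D : ℝ,
          HasDerivWithinAt (fun τ => linEnergy κ (r τ) (s τ) (w τ)) D (Icc 0 T) t ∧
          |D| ≤ K * Mv * linEnergy κ (r t) (s t) (w t) := by
  have : NeZero d := ⟨by omega⟩
  refine ⟨κ * d + 2, by positivity, ?_⟩
  rintro T hT r v s w hr hv hs hw hbdd ⟨c, C, hc, hcC, hnd⟩ hmass hmom hlinmass hlinmom t ht Mv -
    hMv
  obtain ⟨R, -, hR⟩ := exists_norm_le_of_pos hT hr hv hbdd hc hcC hnd hmass hmom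
  obtain ⟨hi, hderiv⟩ := hasDerivWithinAt_linEnergy hκ hr hv hs hw hR hc hcC hnd hmass hlinmass
    hlinmom ht
  refine ⟨_, hderiv, ?_⟩
  rw [linEnergy, ← integral_const_mul, ← Real.norm_eq_abs]
  have hΩ : MeasurableSet {x | 0 < r t x} :=
    (isOpen_lt continuous_const (contDiff_slice hr t).continuous).measurableSet
  exact norm_integral_le_of_norm_le (hi.const_mul _) ((ae_restrict_iff' hΩ).2
    (.of_forall fun x hx => abs_energyRate_rpow_le hκ hx (hMv x hx)))
end
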